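/- Fix ℓ ≥ 1 and a pattern (a_0, ..., a_{ℓ-1}) ∈ F_2^ℓ with exactly w coordinates equal to 1. Let N_ℓ(w) denote the number of n ∈ {0, 1, ..., T-ℓ} with s_{n+i} = a_i for all i = 0, ..., ℓ-1. Then N_ℓ(w) = ((1/(2 - φ(p-1)/p))^w · ((1 - φ(p-1)/p)/(2 - φ(p-1)/p))^{ℓ-w} + o(1))·T as p → ∞ through the primes; that is, for every ε > 0 there exists P such that for all primes p ≥ P, |N_ℓ(w) - T·(1/(2-η))^w·((1-η)/(2-η))^{ℓ-w}| ≤ ε·T, where η = φ(p-1)/p. -/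

import Mathlib

/-- The primitive roots modulo `p` in increasing order: `g_1 < g_2 < … < g_{φ(p-1)}`
(0-indexed as a sorted list). -/
noncomputable def primRootsList (p : ℕ) : List ℕ :=
  ((Finset.Ico 1 p).filter fun g : ℕ => orderOf ((g : ZMod p)) = p - 1).sort (· ≤ ·)

/-- The binary sequence `s_n ≡ g_{n+1} + g_{n+2} (mod 2)` of period `T = φ(p-1) - 1`,
extended `T`-periodically. -/
noncomputable def seqS (p n : ℕ) : ℕ :=
  ((primRootsList p).getD (n % (Nat.totient (p - 1) - 1)) 0 +
    (primRootsList p).getD (n % (Nat.totient (p - 1) - 1) + 1) 0) % 2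

section StepanovMethod
open Polynomial

theorem irreducible_X_pow_sub_C_of_pow_ne {F : Type*} [Field F] {d : ℕ} (hd : 0 < d) {a : F}
    (h : ∀ r : ℕ, 0 < r → r < d → ∀ e : F, e ^ d ≠ a ^ r) :
    Irreducible (X ^ d - C a : F[X]) := by
  have hmon : (X ^ d - C a : F[X]).Monic := monic_X_pow_sub_C a hd.ne'
  rw [hmon.irreducible_iff_natDegree']
  refine ⟨fun h1 => ?_, ?_⟩
  · have := congrArg natDegree h1
    rw [natDegree_X_pow_sub_C, natDegree_one] at this
    omega
  rintro u v hu hv huv hmem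
  rw [natDegree_X_pow_sub_C] at hmem
  simp only [Finset.mem_Ioc] at hmem
  set r := v.natDegree
  let E := AlgebraicClosure F
  have hvs : (v.map (algebraMap F E)).Splits := IsAlgClosed.splits _
  have hvm : (v.map (algebraMap F E)).Monic := hv.map _
  have hc := hvs.coeff_zero_eq_prod_roots_of_monic hvm
  have hroot : ∀ b ∈ (v.map (algebraMap F E)).roots, b ^ d = algebraMap F E a := by
    intro b hb
    rw [mem_roots hvm.ne_zero, IsRoot.def, eval_map] at hb
    have h2 : eval₂ (algebraMap F E) b (X ^ d - C a) = 0 := by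
      rw [← huv, eval₂_mul, hb, mul_zero]
    simpa [sub_eq_zero] using h2
  have hprod : (v.map (algebraMap F E)).roots.prod ^ d = (algebraMap F E a) ^ r := by
    have h1 := Multiset.prod_map_pow (m := (v.map (algebraMap F E)).roots) (f := id) (n := d)
    simp only [id, Multiset.map_id'] at h1
    rw [← h1, Multiset.map_congr rfl hroot, Multiset.map_const',
      Multiset.prod_replicate, hvs.natDegree_eq_card_roots.symm, natDegree_map]
  refine h r hmem.1 (by omega) ((-1) ^ r * v.coeff 0) ?_
  apply (algebraMap F E).injective
  rw [coeff_map, natDegree_map] at hc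
  rw [map_pow, map_mul, hc, map_pow, map_pow, map_neg, map_one, ← mul_assoc, ← pow_add,
    ← two_mul, pow_mul]
  simpa using hprod

/-- The specialization `Z ↦ X ^ N` of a polynomial in `X` with coefficients in `K[Z]`. -/
noncomputable def specializePow (K : Type*) [Field K] (N : ℕ) : K[X][X] →+* K[X] :=
  eval₂RingHom (expand K N : K[X] →+* K[X]) X

theorem specializePow_injective_of_natDegree_lt {K : Type*} [Field K] {N : ℕ} {P : K[X][X]}
    (hP : P.natDegree < N) (h : specializePow K N P = 0) : P = 0 := by
  ext a j
  rw [coeff_zero, coeff_zero]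
  by_cases ha : P.natDegree < a
  · rw [coeff_eq_zero_of_natDegree_lt ha, coeff_zero]
  have hc := congrArg (fun q : K[X] => q.coeff (N * j + a)) h
  have : (specializePow K N P).coeff (N * j + a) = (P.coeff a).coeff j := by
    rw [specializePow, coe_eval₂RingHom, eval₂_eq_sum_range, finsetSum_coeff,
      Finset.sum_eq_single a]
    · rw [coeff_mul_X_pow]
      simp [coeff_expand (by omega : 0 < N), Nat.mul_div_cancel_left j (by omega : 0 < N)]
    · intro b hb hba
      rw [Finset.mem_range] at hb
      rw [coeff_mul_X_pow']
      split_ifs with hle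
      · simp only [RingHom.coe_coe, coeff_expand (by omega : 0 < N)]
        rw [if_neg]
        rintro ⟨c, hc⟩
        apply hba
        have h1 : N * j + a = N * c + b := by omega
        have h2 := congrArg (· % N) h1
        simp only [Nat.mul_add_mod] at h2
        rw [Nat.mod_eq_of_lt (by omega), Nat.mod_eq_of_lt (by omega)] at h2
        exact h2.symm
      · rfl
    · intro hn
      exact absurd (Finset.mem_range.2 (by omega)) hn
  simpa [this] using hc

theorem natDegree_resultant_le {K : Type*} [Field K] {B m n : ℕ} (P Q : K[X][X][X])
    (hP : ∀ i, (P.coeff i).natDegree ≤ B) (hQ : ∀ i, (Q.coeff i).natDegree ≤ B) :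
    (resultant P Q m n).natDegree ≤ (m + n) * B := by
  rw [resultant, Matrix.det_apply]
  refine natDegree_sum_le_of_forall_le _ _ fun σ _ => ?_
  refine (natDegree_smul_le _ _).trans ?_
  refine (natDegree_prod_le _ _).trans ?_
  refine (Finset.sum_le_card_nsmul _ _ B fun i _ => ?_).trans (by simp)
  rw [sylvester, Matrix.of_apply]
  induction i using Fin.addCases with
  | left j => 
    simp only [Fin.addCases_left]
    split_ifs
    · exact hQ _
    · simp
  | right j =>
    simp only [Fin.addCases_right]
    split_ifs
    · exact hP _
    · simp

theorem dvd_of_pow_mul_pow_eq {D : Type*} [CommRing D] [IsDomain D] {α β a b : D[X]} {s : D}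
    {d r : ℕ} (hd : 0 < d) (ha : a ≠ 0) (hb : b ≠ 0) (hβ : β ≠ 0) (hbs : b.rootMultiplicity s = 0)
    (h : α ^ d * a ^ r = b ^ r * β ^ d) : d ∣ r * a.rootMultiplicity s := by
  classical
  have hne : b ^ r * β ^ d ≠ 0 := mul_ne_zero (pow_ne_zero _ hb) (pow_ne_zero _ hβ)
  have hα : α ≠ 0 := by
    rintro rfl
    rw [zero_pow hd.ne', zero_mul] at h
    exact hne h.symm
  have h2 := congrArg (fun q : D[X] => q.roots.count s) h
  rw [roots_mul (mul_ne_zero (pow_ne_zero _ hα) (pow_ne_zero _ ha)),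
    roots_mul hne] at h2
  simp only [roots_pow, Multiset.count_add, Multiset.count_nsmul, count_roots, hbs, mul_zero,
    zero_add] at h2
  exact (Nat.dvd_add_right (dvd_mul_right d _)).1 (h2 ▸ dvd_mul_right _ _)

theorem exists_pow_mul_pow_eq {D F : Type*} [CommRing D] [IsDomain D] [Field F] [Algebra D F]
    [IsFractionRing D F] {a b : D} (ha : a ≠ 0) {d r : ℕ} (e : F)
    (h : e ^ d = (algebraMap D F b / algebraMap D F a) ^ r) :
    ∃ α β : D, β ≠ 0 ∧ α ^ d * a ^ r = b ^ r * β ^ d := by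
  obtain ⟨α, β, hβ, rfl⟩ := IsFractionRing.div_surjective (A := D) e
  have hβ0 : β ≠ 0 := nonZeroDivisors.ne_zero hβ
  have hinj := IsFractionRing.injective D F
  have hne : ∀ x : D, x ≠ 0 → algebraMap D F x ≠ 0 := fun x hx => (map_ne_zero_iff _ hinj).2 hx
  rw [div_pow, div_pow, div_eq_div_iff (pow_ne_zero _ (hne _ hβ0)) (pow_ne_zero _ (hne _ ha))] at h
  simp only [← map_pow, ← map_mul] at h
  exact ⟨α, β, hβ0, hinj h⟩

theorem dvd_of_pow_eq_div_pow {K F : Type*} [Field K] [Field F] [Algebra K[X][X] F]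
    [IsFractionRing K[X][X] F] {f : K[X]} (hf : f ≠ 0) {d r : ℕ} (hd : 0 < d) (e : F)
    (h : e ^ d = (algebraMap K[X][X] F (C f) / algebraMap K[X][X] F (f.map C)) ^ r) (s : K) :
    d ∣ r * f.rootMultiplicity s := by
  have ha0 : f.map C ≠ 0 := (Polynomial.map_ne_zero_iff C_injective).2 hf
  obtain ⟨α, β, hβ, hαβ⟩ := exists_pow_mul_pow_eq ha0 e h
  rw [eq_rootMultiplicity_map (C_injective (R := K))]
  refine dvd_of_pow_mul_pow_eq hd ha0 (C_ne_zero.2 hf) hβ ?_ hαβ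
  rw [rootMultiplicity_eq_zero]
  simpa [IsRoot] using hf

theorem eq_zero_of_sum_specializePow_mul_pow_eq_zero {K : Type*} [Field K] {N d A : ℕ} {f g : K[X]}
    (hf : f ≠ 0) (hd : 0 < d) (hfd : ∀ r, (∀ s, d ∣ r * f.rootMultiplicity s) → d ∣ r)
    (hN : 2 * d * (A + f.natDegree) < N) (hg : f * g ^ d = expand K N f) (k : ℕ → K[X][X])
    (hk : ∀ i < d, (k i).natDegree ≤ A)
    (h : ∑ i ∈ Finset.range d, specializePow K N (k i) * g ^ i = 0) : ∀ i < d, k i = 0 := by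
  set a : K[X][X] := f.map C with ha
  set b : K[X][X] := C f with hb
  have ha0 : a ≠ 0 := (Polynomial.map_ne_zero_iff C_injective).2 hf
  set F := FractionRing K[X][X]
  have hinj := IsFractionRing.injective K[X][X] F
  set P : K[X][X][X] := C a * X ^ d - C b with hP
  set Q : K[X][X][X] := ∑ i ∈ Finset.range d, C (k i) * X ^ i with hQ
  have hQc : ∀ i, Q.coeff i = if i < d then k i else 0 := by
    intro i
    simp [hQ, coeff_C_mul, coeff_X_pow]
  suffices Q = 0 by
    intro i hi
    have := hQc i
    rw [if_pos hi] at this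
    rw [← this, ‹Q = 0›, coeff_zero]
  by_contra hQ0
  have hQd : Q.natDegree < d := by
    rw [natDegree_lt_iff_degree_lt hQ0]
    rw [degree_lt_iff_coeff_zero]
    intro i hi
    rw [hQc, if_neg (by omega)]
  have hPd : P.natDegree = d := by
    rw [hP, natDegree_sub_C, natDegree_C_mul_X_pow _ _ ha0]
  have hira : Irreducible (X ^ d - C (algebraMap _ F b / algebraMap _ F a) : F[X]) := by
    apply irreducible_X_pow_sub_C_of_pow_ne hd
    intro r hr hrd e he
    have := Nat.le_of_dvd hr (hfd r fun s => dvd_of_pow_eq_div_pow hf hd e he s)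
    omega
  have haF : algebraMap _ F a ≠ 0 := (map_ne_zero_iff _ hinj).2 ha0
  have hPmap : P.map (algebraMap _ F) =
      C (algebraMap _ F a) * (X ^ d - C (algebraMap _ F b / algebraMap _ F a)) := by
    rw [hP, mul_sub, ← C_mul, mul_div_cancel₀ _ haF]
    simp
  have hcop : IsCoprime (P.map (algebraMap _ F)) (Q.map (algebraMap _ F)) := by
    rw [hPmap, isCoprime_mul_unit_left_left (isUnit_C.2 haF.isUnit)]
    refine (hira.coprime_iff_not_dvd).2 fun hdvd => ?_
    have h1 := natDegree_le_of_dvd hdvd ((Polynomial.map_ne_zero_iff hinj).2 hQ0)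
    rw [natDegree_X_pow_sub_C, natDegree_map_eq_of_injective hinj] at h1
    omega
  have hres : resultant P Q ≠ 0 := by
    have h1 := resultant_ne_zero _ _ hcop
    rw [natDegree_map_eq_of_injective hinj, natDegree_map_eq_of_injective hinj,
      resultant_map_map] at h1
    exact fun h0 => h1 (by rw [h0, map_zero])
  obtain ⟨u, v, -, -, huv⟩ := exists_mul_add_mul_eq_C_resultant P Q le_rfl le_rfl
    (Or.inl (by omega : P.natDegree ≠ 0))
  apply hres
  apply specializePow_injective_of_natDegree_lt (N := N)
  · refine (natDegree_resultant_le (B := A + f.natDegree) P Q ?_ ?_).trans_lt ?_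
    · intro i
      rw [hP, coeff_sub]
      refine (natDegree_sub_le _ _).trans (max_le ?_ ?_)
      · rw [coeff_C_mul, coeff_X_pow]
        split_ifs
        · rw [mul_one, ha]
          exact natDegree_map_le.trans (by omega)
        · simp
      · rw [coeff_C]
        split_ifs
        · rw [hb, natDegree_C]; omega
        · simp
    · intro i
      rw [hQc]
      split_ifs with hi
      · exact (hk i hi).trans (by omega)
      · simp
    · refine lt_of_le_of_lt (Nat.mul_le_mul_right _ ?_) hN
      omega
  · have h1 := congrArg (eval₂ (specializePow K N) g) huv
    have hPe : eval₂ (specializePow K N) g P = 0 := by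
      have e1 : specializePow K N a = f := by
        rw [ha, specializePow, coe_eval₂RingHom, eval₂_map]
        have : ((expand K N : K[X] →+* K[X])).comp C = C := by
          ext x; simp
        rw [this, eval₂_C_X]
      have e2 : specializePow K N b = expand K N f := by
        rw [hb, specializePow, coe_eval₂RingHom, eval₂_C]; rfl
      rw [hP, eval₂_sub, eval₂_mul, eval₂_C, eval₂_C, eval₂_X_pow, e1, e2, hg, sub_self]
    have hQe : eval₂ (specializePow K N) g Q = 0 := by
      rw [hQ, eval₂_finsetSum, ← h]
      refine Finset.sum_congr rfl fun i _ => ?_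
      rw [eval₂_mul, eval₂_C, eval₂_X_pow]
    rw [eval₂_add, eval₂_mul, eval₂_mul, hPe, hQe, eval₂_C] at h1
    simpa using h1.symm

/-- The polynomials `E` with `derivative^[t] (k * f ^ N) = E * f ^ (N - t)`. -/
noncomputable def derivCofactor {K : Type*} [Field K] (f : K[X]) (N : ℕ) (k : K[X]) : ℕ → K[X]
  | 0 => k
  | t + 1 => derivative (derivCofactor f N k t) * f +
      C ((N - t : ℕ) : K) * derivative f * derivCofactor f N k t

theorem natDegree_derivCofactor_le {K : Type*} [Field K] (f : K[X]) (N : ℕ) (k : K[X]) (t : ℕ) :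
    (derivCofactor f N k t).natDegree ≤ k.natDegree + t * f.natDegree := by
  induction t with
  | zero => simp [derivCofactor]
  | succ t ih =>
    rw [derivCofactor]
    refine (natDegree_add_le _ _).trans (max_le ?_ ?_)
    · refine natDegree_mul_le.trans ?_
      have := natDegree_derivative_le (derivCofactor f N k t)
      rw [add_mul]
      omega
    · refine natDegree_mul_le.trans ?_
      have h1 := natDegree_C_mul_le ((N - t : ℕ) : K) (derivative f)
      have h2 := natDegree_derivative_le f
      rw [add_mul]
      omega

theorem iterate_derivative_mul_pow_mul {K : Type*} [Field K] (f : K[X]) (N : ℕ) (k Y : K[X])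
    (hY : derivative Y = 0) (t : ℕ) (ht : t ≤ N) :
    derivative^[t] (k * f ^ N * Y) = derivCofactor f N k t * f ^ (N - t) * Y := by
  induction t with
  | zero => simp [derivCofactor]
  | succ t ih =>
    rw [Function.iterate_succ_apply', ih (by omega), derivCofactor, derivative_mul, hY,
      derivative_mul, derivative_pow]
    obtain ⟨n, hn⟩ : ∃ n, N - t = n + 1 := ⟨N - t - 1, by omega⟩
    rw [show N - (t + 1) = n by omega, hn]
    simp only [Nat.add_sub_cancel, pow_succ]
    ring

theorem mul_card_le_natDegree_of_le_rootMultiplicity {K : Type*} [Field K] {R : K[X]} {M : ℕ}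
    (T : Finset K) (h : ∀ x ∈ T, M ≤ R.rootMultiplicity x) : M * T.card ≤ R.natDegree := by
  classical
  calc M * T.card = ∑ x ∈ T, M := by rw [Finset.sum_const, smul_eq_mul, mul_comm]
    _ ≤ ∑ x ∈ T, R.roots.count x := Finset.sum_le_sum fun x hx => by
        rw [count_roots]; exact h x hx
    _ ≤ ∑ x ∈ T ∪ R.roots.toFinset, R.roots.count x :=
        Finset.sum_le_sum_of_subset Finset.subset_union_left
    _ = Multiset.card R.roots := Multiset.sum_count_eq_card fun a ha =>
        Finset.mem_union_right _ (Multiset.mem_toFinset.2 ha)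
    _ ≤ R.natDegree := card_roots' R

section Stepanov

variable {p : ℕ} [Fact p.Prime] (f : (ZMod p)[X]) (d u A J M : ℕ)

/-- The auxiliary polynomial of Stepanov's method. -/
noncomputable def stepanovPoly (c : Fin d × Fin J × Fin A → ZMod p) : (ZMod p)[X] :=
  ∑ v, C (c v) * (X ^ (v.2.2 : ℕ) * f ^ (M + u * v.1) * X ^ (p * v.2.1))

/-- The polynomials controlling the vanishing of the derivatives of `stepanovPoly`. -/
noncomputable def stepanovCond (ζ : ZMod p) (c : Fin d × Fin J × Fin A → ZMod p) (t : ℕ) :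
    (ZMod p)[X] :=
  ∑ v, C (c v) * (C (ζ ^ (v.1 : ℕ)) * derivCofactor f (M + u * v.1) (X ^ (v.2.2 : ℕ)) t *
    X ^ (v.2.1 : ℕ))

theorem natDegree_stepanovCond_lt (ζ : ZMod p) (c : Fin d × Fin J × Fin A → ZMod p) {t : ℕ}
    (ht : t < M) : ∀ b, A + M * f.natDegree + J ≤ b →
      (stepanovCond f d u A J M ζ c t).coeff b = 0 := by
  intro b hb
  rw [stepanovCond, finsetSum_coeff]
  refine Finset.sum_eq_zero fun v _ => coeff_eq_zero_of_natDegree_lt ?_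
  refine (natDegree_C_mul_le _ _).trans_lt ?_
  refine natDegree_mul_le.trans_lt ?_
  rw [natDegree_X_pow]
  have h1 := natDegree_C_mul_le (ζ ^ (v.1 : ℕ))
    (derivCofactor f (M + u * v.1) (X ^ (v.2.2 : ℕ)) t)
  have h2 := natDegree_derivCofactor_le f (M + u * v.1) (X ^ (v.2.2 : ℕ)) t
  rw [natDegree_X_pow] at h2
  have h3 : t * f.natDegree ≤ M * f.natDegree := Nat.mul_le_mul_right _ ht.le
  have := v.2.1.2
  have := v.2.2.2
  omega

theorem exists_stepanovCond_eq_zero (ζ : ZMod p)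
    (h : M * (A + M * f.natDegree + J) < d * A * J) :
    ∃ c : Fin d × Fin J × Fin A → ZMod p, c ≠ 0 ∧
      ∀ t < M, stepanovCond f d u A J M ζ c t = 0 := by
  let B := A + M * f.natDegree + J
  let Φ : (Fin d × Fin J × Fin A → ZMod p) →ₗ[ZMod p] (Fin M × Fin B → ZMod p) :=
    { toFun := fun c w => (stepanovCond f d u A J M ζ c w.1).coeff w.2
      map_add' := by
        intro c c'
        ext w
        simp only [stepanovCond, Pi.add_apply, ← coeff_add, ← Finset.sum_add_distrib, ← add_mul,
          ← C_add]
      map_smul' := by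
        intro r c
        ext w
        simp only [stepanovCond, Pi.smul_apply, smul_eq_mul, RingHom.id_apply, ← coeff_C_mul,
          Finset.mul_sum, C_mul, mul_assoc] }
  have hker : LinearMap.ker Φ ≠ ⊥ := by
    apply LinearMap.ker_ne_bot_of_finrank_lt
    rw [Module.finrank_fintype_fun_eq_card, Module.finrank_fintype_fun_eq_card]
    simp only [Fintype.card_prod, Fintype.card_fin]
    calc M * B < d * A * J := h
      _ = d * (J * A) := by ring
  obtain ⟨c, hc, hc0⟩ := (Submodule.ne_bot_iff _).1 hker
  refine ⟨c, hc0, fun t ht => ?_⟩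
  ext b
  by_cases hb : b < B
  · exact congrFun (LinearMap.mem_ker.1 hc) (⟨t, ht⟩, ⟨b, hb⟩)
  · exact natDegree_stepanovCond_lt f d u A J M ζ c ht b (not_lt.1 hb)

theorem eval_iterate_derivative_stepanovPoly {ζ x : ZMod p} (hx : f.eval x ^ u = ζ)
    (c : Fin d × Fin J × Fin A → ZMod p) {t : ℕ} (ht : t < M) :
    (derivative^[t] (stepanovPoly f d u A J M c)).eval x =
      f.eval x ^ (M - t) * (stepanovCond f d u A J M ζ c t).eval x := by
  rw [stepanovPoly, iterate_derivative_sum, stepanovCond, eval_finsetSum, eval_finsetSum,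
    Finset.mul_sum]
  refine Finset.sum_congr rfl fun v _ => ?_
  have hY : derivative (X ^ (p * (v.2.1 : ℕ)) : (ZMod p)[X]) = 0 := by
    rw [derivative_X_pow]
    simp
  rw [iterate_derivative_C_mul, iterate_derivative_mul_pow_mul _ _ _ _ hY _ (by omega)]
  simp only [eval_mul, eval_C, eval_pow, eval_X]
  rw [pow_mul x, ZMod.pow_card, show M + u * (v.1 : ℕ) - t = (M - t) + u * v.1 by omega, pow_add,
    pow_mul, hx]
  ring

theorem natDegree_stepanovPoly_le (hdu : d * u ≤ p) (c : Fin d × Fin J × Fin A → ZMod p) :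
    (stepanovPoly f d u A J M c).natDegree ≤
      M * f.natDegree + A + p * f.natDegree + p * J := by
  refine natDegree_sum_le_of_forall_le _ _ fun v _ => ?_
  refine (natDegree_C_mul_le _ _).trans (natDegree_mul_le.trans ?_)
  have h1 : (X ^ (v.2.2 : ℕ) * f ^ (M + u * v.1) : (ZMod p)[X]).natDegree ≤
      v.2.2 + (M + u * v.1) * f.natDegree := by
    refine natDegree_mul_le.trans ?_
    rw [natDegree_X_pow, natDegree_pow]
  rw [natDegree_X_pow]
  have h2 : u * (v.1 : ℕ) ≤ p := by
    refine le_trans ?_ hdu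
    rw [mul_comm d]
    exact Nat.mul_le_mul_left _ v.1.2.le
  have h3 : (M + u * v.1) * f.natDegree ≤ M * f.natDegree + p * f.natDegree := by
    rw [← add_mul]
    exact Nat.mul_le_mul_right _ (by omega)
  have h4 : p * (v.2.1 : ℕ) ≤ p * J := Nat.mul_le_mul_left _ v.2.1.2.le
  have := v.2.2.2
  omega

theorem stepanovPoly_ne_zero (hf : f ≠ 0) (hdu : d * u = p - 1) (hd : 0 < d)
    (hfd : ∀ r, (∀ s, d ∣ r * f.rootMultiplicity s) → d ∣ r)
    (hp : 2 * d * (A + f.natDegree) < p) {c : Fin d × Fin J × Fin A → ZMod p} (hc : c ≠ 0) :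
    stepanovPoly f d u A J M c ≠ 0 := by
  have hp1 : 1 ≤ p := (Fact.out : p.Prime).one_le
  intro h0
  let k : ℕ → (ZMod p)[X][X] := fun i => if hi : i < d then
    ∑ a : Fin A, monomial a (∑ j : Fin J, monomial j (c (⟨i, hi⟩, j, a))) else 0
  have hsum : f ^ M * ∑ i ∈ Finset.range d, specializePow (ZMod p) p (k i) * (f ^ u) ^ i =
      stepanovPoly f d u A J M c := by
    rw [Finset.sum_range, stepanovPoly, Fintype.sum_prod_type, Finset.mul_sum]
    refine Finset.sum_congr rfl fun i _ => ?_
    rw [Fintype.sum_prod_type_right]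
    simp only [k, i.2, dif_pos, map_sum, Fin.eta, Finset.sum_mul, Finset.mul_sum]
    refine Finset.sum_congr rfl fun a _ => ?_
    refine Finset.sum_congr rfl fun j _ => ?_
    rw [specializePow, coe_eval₂RingHom, eval₂_monomial, RingHom.coe_coe, expand_monomial,
      ← C_mul_X_pow_eq_monomial, pow_add, ← pow_mul, mul_comm p]
    ring
  rw [h0] at hsum
  have hs := (mul_eq_zero.1 hsum).resolve_left (pow_ne_zero _ hf)
  have hk := eq_zero_of_sum_specializePow_mul_pow_eq_zero (g := f ^ u) (A := A) hf hd hfd hp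
    (by
      rw [← pow_mul, mul_comm u, hdu, ZMod.expand_card, ← pow_succ']
      congr 1
      omega) k
    (by
      intro i hi
      simp only [k, hi, dif_pos]
      refine natDegree_sum_le_of_forall_le _ _ fun a _ => ?_
      exact (natDegree_monomial_le _).trans a.2.le) hs
  apply hc
  ext ⟨i, j, a⟩
  have h1 := congrArg (fun q => (coeff q a).coeff j) (hk i i.2)
  simpa [k, finsetSum_coeff, coeff_monomial, Fin.val_inj] using h1

/-- Stepanov's bound for the number of points at which `f ^ u` takes a given value. -/
theorem mul_card_le_of_eval_pow_eq (hf : f ≠ 0) (hdu : d * u = p - 1) (hd : 0 < d)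
    (hfd : ∀ r, (∀ s, d ∣ r * f.rootMultiplicity s) → d ∣ r)
    (hp : 2 * d * (A + f.natDegree) < p) (hM : M ≤ p)
    (h : M * (A + M * f.natDegree + J) < d * A * J) (ζ : ZMod p) (T : Finset (ZMod p))
    (hT : ∀ x ∈ T, f.eval x ^ u = ζ) :
    M * T.card ≤ M * f.natDegree + A + p * f.natDegree + p * J := by
  obtain ⟨c, hc, hcond⟩ := exists_stepanovCond_eq_zero f d u A J M ζ h
  have hne := stepanovPoly_ne_zero f d u A J M hf hdu hd hfd hp hc
  refine (mul_card_le_natDegree_of_le_rootMultiplicity (R := stepanovPoly f d u A J M c) T ?_).trans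
    (natDegree_stepanovPoly_le f d u A J M (by omega) c)
  intro x hx
  rcases Nat.eq_zero_or_pos M with rfl | hM0
  · exact Nat.zero_le _
  suffices M - 1 < (stepanovPoly f d u A J M c).rootMultiplicity x by omega
  apply lt_rootMultiplicity_of_isRoot_iterate_derivative_of_mem_nonZeroDivisors' hne
  · intro t ht
    rw [IsRoot, eval_iterate_derivative_stepanovPoly f d u A J M (hT x hx) c (by omega),
      hcond t (by omega), eval_zero, mul_zero]
  · intro t ht ht0
    rw [mem_nonZeroDivisors_iff_ne_zero, Ne, ZMod.natCast_eq_zero_iff]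
    intro hdvd
    have := Nat.le_of_dvd (Nat.pos_of_ne_zero ht0) hdvd
    omega

end Stepanov

end StepanovMethod

section CharSum

theorem ZMod.exists_isPrimitiveRoot_sub_one (p : ℕ) [Fact p.Prime] :
    ∃ g : ZMod p, IsPrimitiveRoot g (p - 1) := by
  obtain ⟨g, hg⟩ := IsCyclic.exists_generator (α := (ZMod p)ˣ)
  refine ⟨g, ?_⟩
  have h := orderOf_eq_card_of_forall_mem_zpowers hg
  rw [Nat.card_eq_fintype_card, ZMod.card_units_eq_totient, Nat.totient_prime Fact.out] at h
  rw [← h, IsPrimitiveRoot.coe_units_iff]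
  exact IsPrimitiveRoot.orderOf g

variable {p : ℕ} [Fact p.Prime] {d u : ℕ}

theorem ZMod.card_pow_eq_one (hdu : d * u = p - 1) :
    (Finset.univ.filter fun z : ZMod p => z ^ u = 1).card = u := by
  obtain ⟨g, hg⟩ := ZMod.exists_isPrimitiveRoot_sub_one p
  have hp := (Fact.out : p.Prime).two_le
  have hu : 0 < u := Nat.pos_of_ne_zero (by rintro rfl; simp at hdu; omega)
  have h := (hg.pow (by omega) hdu.symm).card_nthRootsFinset
  conv_rhs => rw [← h]
  congr 1
  ext z
  simp [Polynomial.mem_nthRootsFinset hu]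

theorem MulChar.apply_eq_one_of_pow_eq_one (hdu : d * u = p - 1) {ψ : MulChar (ZMod p) ℂ}
    (hψ : ψ ^ d = 1) {z : ZMod p} (hz : z ^ u = 1) : ψ z = 1 := by
  obtain ⟨g, hg⟩ := ZMod.exists_isPrimitiveRoot_sub_one p
  have hp := (Fact.out : p.Prime).two_le
  have hu : 0 < u := Nat.pos_of_ne_zero (by rintro rfl; simp at hdu; omega)
  have : NeZero (p - 1) := ⟨by omega⟩
  obtain ⟨j, -, rfl⟩ := hg.eq_pow_of_pow_eq_one (ξ := z) (by
    rw [← hdu, mul_comm, pow_mul, hz, one_pow])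
  rw [← pow_mul, hg.pow_eq_one_iff_dvd, ← hdu] at hz
  obtain ⟨i, rfl⟩ := Nat.dvd_of_mul_dvd_mul_right hu hz
  have hg0 : IsUnit g := hg.isUnit (by omega)
  rw [map_pow, pow_mul, ← MulChar.pow_apply' _ (by rintro rfl; omega), hψ,
    MulChar.one_apply hg0, one_pow]

theorem MulChar.card_filter_pow_eq (hdu : d * u = p - 1) {y : ZMod p} (hy : y ≠ 0) :
    (Finset.univ.filter fun x : ZMod p => y ^ u = x ^ u).card = u := by
  conv_rhs => rw [← ZMod.card_pow_eq_one hdu]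
  refine Finset.card_bij' (fun x _ => x / y) (fun z _ => z * y) ?_ ?_ ?_ ?_
  · intro x hx
    have : y ^ u ≠ 0 := pow_ne_zero _ hy
    simp only [Finset.mem_filter, Finset.mem_univ, true_and] at hx ⊢
    rw [div_pow, ← hx, div_self this]
  · intro z hz
    simp only [Finset.mem_filter, Finset.mem_univ, true_and] at hz ⊢
    rw [mul_pow, hz, one_mul]
  · intro x _
    exact div_mul_cancel₀ x hy
  · intro z _
    exact mul_div_cancel_right₀ z hy

/-- If every nonzero value is taken at most `U` times by `F ^ u`, then the sum of a nontrivial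
character of order dividing `d` over the values of `F` is small. -/
theorem MulChar.norm_sum_apply_le (hdu : d * u = p - 1) {ψ : MulChar (ZMod p) ℂ}
    (hψ : ψ ^ d = 1) (hψ1 : ψ ≠ 1) (F : ZMod p → ZMod p) {k U : ℕ}
    (hk : (Finset.univ.filter fun n => F n = 0).card ≤ k)
    (hU : ∀ ζ, ζ ≠ 0 → (Finset.univ.filter fun n => F n ^ u = ζ).card ≤ U) :
    ‖∑ n, ψ (F n)‖ ≤ d * U - p + k := by
  have hp := (Fact.out : p.Prime).two_le
  have hu : 0 < u := Nat.pos_of_ne_zero (by rintro rfl; simp at hdu; omega)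
  have hdu' : (d : ℝ) * u = p - 1 := by
    have : ((d * u : ℕ) : ℝ) = ((p - 1 : ℕ) : ℝ) := by rw [hdu]
    rwa [Nat.cast_mul, Nat.cast_sub (by omega), Nat.cast_one] at this
  set N : ZMod p → ℕ := fun x => (Finset.univ.filter fun n => F n ^ u = x ^ u).card with hN
  have hcard : ((Finset.univ.filter fun x : ZMod p => x ≠ 0).card : ℝ) = d * u := by
    rw [Finset.filter_ne' , Finset.card_erase_of_mem (Finset.mem_univ _), Finset.card_univ,
      ZMod.card, hdu', Nat.cast_sub (by omega), Nat.cast_one]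
  have key : ∀ n, ∑ x ∈ Finset.univ.filter (fun x : ZMod p => x ≠ 0),
      (if F n ^ u = x ^ u then ψ x else 0) = u * ψ (F n) := by
    intro n
    by_cases hn : F n = 0
    · rw [hn, MulChar.map_zero, mul_zero]
      refine Finset.sum_eq_zero fun x hx => ?_
      rw [if_neg]
      rw [zero_pow hu.ne']
      exact (pow_ne_zero u (Finset.mem_filter.1 hx).2).symm
    · rw [← Finset.sum_filter, Finset.filter_filter]
      have : (Finset.univ.filter fun x : ZMod p => x ≠ 0 ∧ F n ^ u = x ^ u) =
          Finset.univ.filter fun x : ZMod p => F n ^ u = x ^ u := by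
        refine Finset.filter_congr fun x _ => ⟨fun h => h.2, fun h => ⟨?_, h⟩⟩
        rintro rfl
        rw [zero_pow hu.ne'] at h
        exact hn (eq_zero_of_pow_eq_zero h)
      rw [this, Finset.sum_congr rfl (g := fun _ => ψ (F n)), Finset.sum_const,
        MulChar.card_filter_pow_eq hdu hn, nsmul_eq_mul]
      intro x hx
      have hx := (Finset.mem_filter.1 hx).2
      have h1 := MulChar.apply_eq_one_of_pow_eq_one hdu hψ (z := x / F n) (by
        rw [div_pow, ← hx, div_self (pow_ne_zero _ hn)])
      rw [← div_mul_cancel₀ x hn, map_mul, h1, one_mul]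
  have key2 : ∀ n, ∑ x ∈ Finset.univ.filter (fun x : ZMod p => x ≠ 0),
      (if F n ^ u = x ^ u then (1 : ℝ) else 0) = u - if F n = 0 then (u : ℝ) else 0 := by
    intro n
    split_ifs with hn
    · rw [sub_self]
      refine Finset.sum_eq_zero fun x hx => ?_
      rw [if_neg]
      rw [hn, zero_pow hu.ne']
      exact (pow_ne_zero u (Finset.mem_filter.1 hx).2).symm
    · rw [← Finset.sum_filter, Finset.filter_filter]
      have : (Finset.univ.filter fun x : ZMod p => x ≠ 0 ∧ F n ^ u = x ^ u) =
          Finset.univ.filter fun x : ZMod p => F n ^ u = x ^ u := by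
        refine Finset.filter_congr fun x _ => ⟨fun h => h.2, fun h => ⟨?_, h⟩⟩
        rintro rfl
        rw [zero_pow hu.ne'] at h
        exact hn (eq_zero_of_pow_eq_zero h)
      rw [this, Finset.sum_const, MulChar.card_filter_pow_eq hdu hn, nsmul_eq_mul, mul_one,
        sub_zero]
  have hsum0 : ∑ x ∈ Finset.univ.filter (fun x : ZMod p => x ≠ 0), ψ x = 0 := by
    rw [← MulChar.sum_eq_zero_of_ne_one hψ1]
    refine Finset.sum_filter_of_ne fun x _ hx => ?_
    rintro rfl
    exact hx (MulChar.map_zero _)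
  have h1 : (u : ℂ) * ∑ n, ψ (F n) =
      -∑ x ∈ Finset.univ.filter (fun x : ZMod p => x ≠ 0), ((U - N x : ℝ) : ℂ) * ψ x := by
    rw [Finset.mul_sum, ← Finset.sum_congr rfl fun n _ => key n, Finset.sum_comm]
    simp_rw [Complex.ofReal_sub, sub_mul]
    rw [Finset.sum_sub_distrib, ← Finset.mul_sum, hsum0, mul_zero, zero_sub, neg_neg]
    refine Finset.sum_congr rfl fun x _ => ?_
    rw [← Finset.sum_filter, Finset.sum_const, nsmul_eq_mul]
    simp [hN]
  have h2 : ∑ x ∈ Finset.univ.filter (fun x : ZMod p => x ≠ 0), (N x : ℝ) =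
      u * (p - (Finset.univ.filter fun n => F n = 0).card) := by
    have : ∀ x, (N x : ℝ) = ∑ n, (if F n ^ u = x ^ u then (1 : ℝ) else 0) := by
      intro x
      simp [hN]
    simp_rw [this]
    rw [Finset.sum_comm, Finset.sum_congr rfl fun n _ => key2 n, Finset.sum_sub_distrib,
      Finset.sum_const, ← Finset.sum_filter, Finset.sum_const, Finset.card_univ, ZMod.card]
    simp only [nsmul_eq_mul]
    ring
  have h3 : (u : ℝ) * ‖∑ n, ψ (F n)‖ ≤ u * (d * U - p + k) := by
    calc (u : ℝ) * ‖∑ n, ψ (F n)‖ = ‖(u : ℂ) * ∑ n, ψ (F n)‖ := by simp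
      _ ≤ ∑ x ∈ Finset.univ.filter (fun x : ZMod p => x ≠ 0), ‖((U - N x : ℝ) : ℂ) * ψ x‖ := by
        rw [h1, norm_neg]
        exact norm_sum_le _ _
      _ ≤ ∑ x ∈ Finset.univ.filter (fun x : ZMod p => x ≠ 0), ((U : ℝ) - N x) := by
        refine Finset.sum_le_sum fun x hx => ?_
        have hx0 := (Finset.mem_filter.1 hx).2
        have hle : (N x : ℝ) ≤ U := by exact_mod_cast hU (x ^ u) (pow_ne_zero _ hx0)
        have hone : ‖ψ x‖ = 1 := by
          refine Complex.norm_eq_one_of_pow_eq_one (n := p - 1) ?_ (by omega)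
          rw [← map_pow, ZMod.pow_card_sub_one_eq_one hx0, map_one]
        rw [norm_mul, hone, mul_one, Complex.norm_real, Real.norm_of_nonneg (by linarith)]
      _ = (d * u) * U - u * (p - (Finset.univ.filter fun n => F n = 0).card) := by
        rw [Finset.sum_sub_distrib, h2, Finset.sum_const, nsmul_eq_mul, hcard]
      _ ≤ u * (d * U - p + k) := by
        have : ((Finset.univ.filter fun n => F n = 0).card : ℝ) ≤ k := by exact_mod_cast hk
        have h0 : (0 : ℝ) ≤ u := Nat.cast_nonneg _
        nlinarith
  exact le_of_mul_le_mul_left h3 (by exact_mod_cast hu)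

end CharSum

section StepanovSum
open Polynomial

variable {p : ℕ} [Fact p.Prime]

theorem rootMultiplicity_prod_X_sub_C_pow {K : Type*} [Field K] (S : Finset K) (m : K → ℕ) {s : K}
    (hs : s ∈ S) : (∏ t ∈ S, (X - C t) ^ m t).rootMultiplicity s = m s := by
  classical
  have h0 : (∏ t ∈ S, (X - C t) ^ m t) ≠ 0 :=
    Finset.prod_ne_zero_iff.2 fun t _ => pow_ne_zero _ (X_sub_C_ne_zero t)
  rw [← count_roots, roots_prod _ _ h0, Multiset.count_bind, Finset.sum_map_val]
  simp [Multiset.count_singleton, hs]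

theorem stepanov_parameter_bound {d D J M A m U p : ℝ} (hM : M + 1 = d * J) (hd : 2 ≤ d)
    (hdD : d ≤ D) (hJ : 1 ≤ J) (hm : m ≤ D ^ 2) (hp : 6 * D ^ 5 * J ^ 2 < p)
    (hA : A = 2 * D ^ 4 * J ^ 2) (hU : U * M ≤ M * m + A + p * m + p * J) :
    d * U - p + D ≤ 3 * D ^ 2 * p / J := by
  have hD : 2 ≤ D := hd.trans hdD
  have hM0 : 0 < M := by nlinarith
  have hp0 : 0 < p := lt_of_le_of_lt (by positivity) hp
  rw [le_div_iff₀ (by linarith)]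
  refine le_of_mul_le_mul_left ?_ hM0
  have e1 : M * ((d * U - p + D) * J) = J * (d * (U * M) - p * (d * J - 1) + D * M) := by
    rw [← hM]
    ring
  have e2 : d * (U * M) ≤ d * (M * D ^ 2 + A + p * D ^ 2 + p * J) := by
    gcongr
    refine hU.trans ?_
    gcongr
  have hdM : M ≤ d * J := by linarith
  have hMge : d * J / 2 ≤ M := by nlinarith
  have b1 : A ≤ p / 3 := by
    have : D ^ 4 * J ^ 2 * 1 ≤ D ^ 4 * J ^ 2 * D := by gcongr; linarith
    have : D ^ 4 * J ^ 2 * D = D ^ 5 * J ^ 2 := by ring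
    linarith
  have b2 : M * D ^ 2 ≤ p / 6 := by
    calc M * D ^ 2 ≤ (D * J) * D ^ 2 := by gcongr; exact hdM.trans (by gcongr)
      _ = D ^ 3 * J ^ 1 := by ring
      _ ≤ D ^ 5 * J ^ 2 := by
        gcongr
        · linarith
        · norm_num
        · norm_num
      _ ≤ p / 6 := by linarith
  have b3 : D * M ≤ d * (p / 6) := by
    have h1 : D * M ≤ M * D ^ 2 := by
      rw [mul_comm]
      gcongr
      nlinarith
    have h2 : 1 * (p / 6) ≤ d * (p / 6) := by gcongr; linarith
    linarith
  rw [e1]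
  calc J * (d * (U * M) - p * (d * J - 1) + D * M)
      ≤ J * (d * (p / 6 + p / 3 + p * D ^ 2 + p * J) - p * (d * J - 1) + d * (p / 6)) := by
        refine mul_le_mul_of_nonneg_left ?_ (by linarith)
        have : d * (M * D ^ 2 + A + p * D ^ 2 + p * J) ≤
            d * (p / 6 + p / 3 + p * D ^ 2 + p * J) := by gcongr
        linarith
    _ = J * (d * p * (2 / 3 + D ^ 2) + p) := by ring
    _ ≤ J * (d * p * (3 / 2 * D ^ 2)) := by
        refine mul_le_mul_of_nonneg_left ?_ (by linarith)
        have h4 : 4 ≤ D ^ 2 := by nlinarith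
        have h5 : 2 * p ≤ d * p := by gcongr
        have h6 : d * p * 4 ≤ d * p * D ^ 2 := by gcongr
        linarith
    _ = d * J / 2 * (3 * D ^ 2 * p) := by ring
    _ ≤ M * (3 * D ^ 2 * p) := by gcongr

/-- A Weil-type bound with a weak constant, from Stepanov's method. -/
theorem MulChar.norm_sum_prod_pow_le {d u D J : ℕ} (hdu : d * u = p - 1) (hd : 2 ≤ d) (hdD : d ≤ D)
    {S : Finset (ZMod p)} (hS : S.card ≤ D) {m : ZMod p → ℕ} (hm : ∀ s ∈ S, m s ≤ d)
    (hgcd : ∀ r, (∀ s ∈ S, d ∣ r * m s) → d ∣ r) {ψ : MulChar (ZMod p) ℂ} (hψ : ψ ^ d = 1)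
    (hψ1 : ψ ≠ 1) (hJ : 1 ≤ J) (hp : 6 * D ^ 5 * J ^ 2 < p) :
    ‖∑ n, ∏ s ∈ S, ψ (n - s) ^ m s‖ ≤ 3 * D ^ 2 * p / J := by
  set f : (ZMod p)[X] := ∏ t ∈ S, (X - C t) ^ m t with hf
  have hf0 : f ≠ 0 := Finset.prod_ne_zero_iff.2 fun t _ => pow_ne_zero _ (X_sub_C_ne_zero t)
  have heval : ∀ n, f.eval n = ∏ s ∈ S, (n - s) ^ m s := by
    intro n
    simp [hf, eval_prod]
  have hdeg : f.natDegree ≤ D ^ 2 := by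
    rw [hf, natDegree_prod _ _ fun t _ => pow_ne_zero _ (X_sub_C_ne_zero t)]
    calc ∑ t ∈ S, ((X - C t) ^ m t).natDegree ≤ ∑ _t ∈ S, D :=
        by
          refine Finset.sum_le_sum fun t ht => ?_
          rw [natDegree_pow, natDegree_X_sub_C, mul_one]
          exact (hm t ht).trans hdD
      _ ≤ D ^ 2 := by
          rw [Finset.sum_const, smul_eq_mul, sq]
          exact Nat.mul_le_mul_right _ hS
  have hp2 := (Fact.out : p.Prime).two_le
  have hu : 0 < u := Nat.pos_of_ne_zero (by rintro rfl; simp at hdu; omega)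
  have hzero : (Finset.univ.filter fun n => f.eval n = 0).card ≤ D := by
    refine (Finset.card_le_card fun n hn => ?_).trans hS
    have h := (Finset.mem_filter.1 hn).2
    rw [heval, Finset.prod_eq_zero_iff] at h
    obtain ⟨s, hs, h⟩ := h
    rw [sub_eq_zero.1 (eq_zero_of_pow_eq_zero h)]
    exact hs
  have hD : 2 ≤ D := hd.trans hdD
  obtain ⟨M, hM⟩ : ∃ M, M + 1 = d * J :=
    ⟨d * J - 1, Nat.sub_add_cancel (Nat.mul_pos (by omega) hJ)⟩
  have hM0 : 0 < M := by nlinarith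
  have hJ2 : J ≤ J ^ 2 := by nlinarith
  have hD5 : D ≤ D ^ 5 := Nat.le_self_pow (by norm_num) D
  have hD35 : D ^ 3 ≤ D ^ 5 := Nat.pow_le_pow_right (by omega) (by norm_num)
  have hdJ : d * J ≤ D ^ 5 * J ^ 2 := Nat.mul_le_mul (hdD.trans hD5) hJ2
  have hMp : M ≤ p := by nlinarith
  set A := 2 * D ^ 4 * J ^ 2 with hA
  have hcond1 : 2 * d * (A + f.natDegree) < p := by
    calc 2 * d * (A + f.natDegree) ≤ 2 * D * (2 * D ^ 4 * J ^ 2 + D ^ 2) := by gcongr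
      _ = 4 * D ^ 5 * J ^ 2 + 2 * (D ^ 3 * 1) := by ring
      _ ≤ 4 * D ^ 5 * J ^ 2 + 2 * (D ^ 5 * J ^ 2) := by
        gcongr
        exact Nat.one_le_pow _ _ hJ
      _ < p := by linarith
  have hcond2 : M * (A + M * f.natDegree + J) < d * A * J := by
    have h1 : M * (M * f.natDegree + J) < A := by
      calc M * (M * f.natDegree + J) < (d * J) * ((d * J) * D ^ 2 + J) := by
            refine Nat.mul_lt_mul_of_lt_of_le (by omega) ?_ (by positivity)
            gcongr
            omega
        _ ≤ (D * J) * ((D * J) * D ^ 2 + J) := by gcongr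
        _ = D ^ 4 * J ^ 2 + D * J ^ 2 := by ring
        _ ≤ D ^ 4 * J ^ 2 + D ^ 4 * J ^ 2 := by
            gcongr
            exact Nat.le_self_pow (by norm_num) D
        _ = A := by rw [hA]; ring
    have h2 : d * A * J = M * A + A := by
      rw [mul_right_comm, ← hM]
      ring
    rw [h2, add_assoc, mul_add]
    omega
  set U := (M * f.natDegree + A + p * f.natDegree + p * J) / M with hU
  have hUle : ∀ ζ, ζ ≠ 0 → (Finset.univ.filter fun n => f.eval n ^ u = ζ).card ≤ U := by
    intro ζ _
    rw [hU, Nat.le_div_iff_mul_le hM0, mul_comm]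
    refine mul_card_le_of_eval_pow_eq f d u A J M hf0 hdu (by omega) ?_ hcond1 hMp hcond2 ζ _
      fun x hx => (Finset.mem_filter.1 hx).2
    intro r hr
    refine hgcd r fun s hs => ?_
    rw [← rootMultiplicity_prod_X_sub_C_pow S m hs]
    exact hr s
  have hmain := MulChar.norm_sum_apply_le hdu hψ hψ1 (fun n => f.eval n) hzero hUle
  have hsum : ∑ n, ∏ s ∈ S, ψ (n - s) ^ m s = ∑ n, ψ (f.eval n) :=
    Finset.sum_congr rfl fun n _ => by simp [heval, map_prod, map_pow]
  rw [hsum]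
  refine hmain.trans ?_
  have hUM : (U : ℝ) * M ≤ M * f.natDegree + A + p * f.natDegree + p * J := by
    exact_mod_cast Nat.div_mul_le_self (M * f.natDegree + A + p * f.natDegree + p * J) M
  exact stepanov_parameter_bound (by exact_mod_cast hM) (by exact_mod_cast hd)
    (by exact_mod_cast hdD) (by exact_mod_cast hJ) (by exact_mod_cast hdeg) (by exact_mod_cast hp)
    (by rw [hA]; push_cast; ring) hUM

end StepanovSum

section Equidistribution

variable {p : ℕ} [Fact p.Prime] {ι : Type*} [Fintype ι]

theorem MulChar.norm_sum_prod_pow_le_of_orderOf {χ : MulChar (ZMod p) ℂ} (hχ : orderOf χ = p - 1)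
    {s : ι → ZMod p} (hs : Function.Injective s) {E : ι → ℕ} {L D : ℕ}
    (hLE : ∀ i, p - 1 ∣ L * E i) (hE : ∀ i, E i ≤ p - 1) (hE0 : ∃ i, ¬ p - 1 ∣ E i) (hL : 0 < L)
    (hLD : L ≤ D) (hι : Fintype.card ι ≤ D) (hp : 6 * D ^ 13 < p) :
    ‖∑ n, ∏ i, χ (n - s i) ^ E i‖ ≤ 3 * p / D ^ 2 := by
  classical
  have hp2 := (Fact.out : p.Prime).two_le
  set c := Nat.gcd (p - 1) (Finset.univ.gcd E) with hc
  have hcp : c ∣ p - 1 := Nat.gcd_dvd_left _ _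
  have hcE : ∀ i, c ∣ E i := fun i =>
    (Nat.gcd_dvd_right _ _).trans (Finset.gcd_dvd (Finset.mem_univ i))
  have hmul : ∀ r, (∀ i, p - 1 ∣ r * E i) → p - 1 ∣ r * c := by
    intro r hr
    rw [hc, ← Nat.gcd_mul_left]
    refine Nat.dvd_gcd (dvd_mul_left _ _) ?_
    have h := Finset.gcd_mul_left (s := Finset.univ) (f := E) (a := r)
    rw [normalize_eq] at h
    rw [← h]
    exact Finset.dvd_gcd fun i _ => hr i
  have hc0 : 0 < c := Nat.pos_of_dvd_of_pos hcp (by omega)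
  obtain ⟨d, hd⟩ := hcp
  have hcne : c ≠ p - 1 := by
    intro h
    obtain ⟨i, hi⟩ := hE0
    exact hi (h ▸ hcE i)
  have hd2 : 2 ≤ d := by
    rcases d with _ | _ | d
    · omega
    · exact absurd (by simpa using hd.symm) hcne
    · omega
  have hdvd : ∀ r, p - 1 ∣ r * c → d ∣ r := by
    intro r hr
    rw [hd, mul_comm] at hr
    exact Nat.dvd_of_mul_dvd_mul_right hc0 hr
  have hdD : d ≤ D := (Nat.le_of_dvd hL (hdvd L (hmul L hLE))).trans hLD
  choose m hm using hcE
  have hD : 2 ≤ D := hd2.trans hdD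
  have hcard : (Finset.univ.map ⟨s, hs⟩).card ≤ D := by simpa using hι
  have key := MulChar.norm_sum_prod_pow_le (u := c) (J := D ^ 4) (S := Finset.univ.map ⟨s, hs⟩)
    (m := Function.extend s m 0) (ψ := χ ^ c) (by rw [hd, mul_comm]) hd2 hdD hcard ?_ ?_ ?_ ?_
    (Nat.one_le_pow _ _ (by omega)) (by rw [← pow_mul, mul_assoc, ← pow_add]; exact hp)
  · simp only [Finset.prod_map, Function.Embedding.coeFn_mk, hs.extend_apply,
      MulChar.pow_apply' _ hc0.ne', ← pow_mul, ← hm] at key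
    refine key.trans (le_of_eq ?_)
    have : (D : ℝ) ≠ 0 := by positivity
    push_cast
    field_simp
  · intro t ht
    obtain ⟨i, -, rfl⟩ := Finset.mem_map.1 ht
    simp only [Function.Embedding.coeFn_mk, hs.extend_apply]
    have := hE i
    rw [hm i, hd] at this
    exact Nat.le_of_mul_le_mul_left this hc0
  · intro r hr
    refine hdvd r (hmul r fun i => ?_)
    have := hr (s i) (Finset.mem_map.2 ⟨i, Finset.mem_univ _, rfl⟩)
    rw [hs.extend_apply] at this
    rw [hm i, hd, mul_left_comm]
    exact mul_dvd_mul_left c this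
  · rw [← pow_mul, ← hd, ← hχ, pow_orderOf_eq_one]
  · intro h
    have := orderOf_dvd_of_pow_eq_one h
    rw [hχ] at this
    exact hcne (Nat.dvd_antisymm ⟨d, hd⟩ this)

theorem ZMod.exists_mulChar_orderOf_eq (p : ℕ) [Fact p.Prime] :
    ∃ χ : MulChar (ZMod p) ℂ, orderOf χ = p - 1 := by
  have hp2 := (Fact.out : p.Prime).two_le
  exact MulChar.exists_mulChar_orderOf (ZMod p) (by rw [ZMod.card])
    (Complex.isPrimitiveRoot_exp (p - 1) (by omega))

theorem MulChar.apply_eq_one_iff_of_orderOf {χ : MulChar (ZMod p) ℂ} (hχ : orderOf χ = p - 1)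
    {x : ZMod p} (hx : x ≠ 0) : χ x = 1 ↔ x = 1 := by
  refine ⟨fun h => ?_, fun h => by rw [h, map_one]⟩
  have hp2 := (Fact.out : p.Prime).two_le
  obtain ⟨g, hg⟩ := ZMod.exists_isPrimitiveRoot_sub_one p
  have : NeZero (p - 1) := ⟨by omega⟩
  obtain ⟨j, -, rfl⟩ := hg.eq_pow_of_pow_eq_one (ZMod.pow_card_sub_one_eq_one hx)
  have hχg : χ ^ j = 1 := by
    ext a
    obtain ⟨i, -, hi⟩ := hg.eq_pow_of_pow_eq_one (ZMod.pow_card_sub_one_eq_one a.ne_zero)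
    rw [MulChar.one_apply a.isUnit]
    rcases Nat.eq_zero_or_pos j with rfl | hj
    · rw [pow_zero, MulChar.one_apply a.isUnit]
    · rw [MulChar.pow_apply' _ hj.ne', ← hi, ← map_pow, ← pow_mul, mul_comm, pow_mul, map_pow, h,
        one_pow]
  rw [hg.pow_eq_one_iff_dvd, ← hχ]
  exact orderOf_dvd_of_pow_eq_one hχg

theorem MulChar.sum_pow_div_eq_ite {χ : MulChar (ZMod p) ℂ} (hχ : orderOf χ = p - 1)
    {d : ℕ} (hd : d ∣ p - 1) {x : ZMod p} (hx : x ≠ 0) :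
    (1 / d : ℂ) * ∑ j ∈ Finset.range d, χ x ^ (j * ((p - 1) / d)) =
      if x ^ ((p - 1) / d) = 1 then 1 else 0 := by
  have hp2 := (Fact.out : p.Prime).two_le
  have hd0 : (d : ℂ) ≠ 0 := by
    rw [Nat.cast_ne_zero]
    rintro rfl
    rw [zero_dvd_iff] at hd
    omega
  have h1 := MulChar.apply_eq_one_iff_of_orderOf hχ (pow_ne_zero ((p - 1) / d) hx)
  simp_rw [mul_comm _ ((p - 1) / d), pow_mul]
  rw [map_pow] at h1
  split_ifs with h
  · rw [h1.2 h]
    simp [hd0]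
  · have hne : χ x ^ ((p - 1) / d) ≠ 1 := fun h' => h (h1.1 h')
    have hpow : (χ x ^ ((p - 1) / d)) ^ d = 1 := by
      rw [← pow_mul, Nat.div_mul_cancel hd, ← map_pow, ZMod.pow_card_sub_one_eq_one hx, map_one]
    rw [geom_sum_eq hne, hpow, sub_self, zero_div, mul_zero]

/-- Joint equidistribution of power residue conditions at distinct shifts. -/
theorem ZMod.abs_card_forall_pow_div_eq_one_sub_le {s : ι → ZMod p} (hs : Function.Injective s)
    {e : ι → ℕ} {L D : ℕ} (heL : ∀ i, e i ∣ L) (hLp : L ∣ p - 1)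
    (hLD : L ≤ D) (hι : Fintype.card ι ≤ D) (hp : 6 * D ^ 13 < p) :
    |((Finset.univ.filter fun n : ZMod p => ∀ i, (n - s i) ^ ((p - 1) / e i) = 1).card : ℝ) -
      p * ∏ i, (1 / e i : ℝ)| ≤ Fintype.card ι + 3 * p / D ^ 2 := by
  classical
  have hp2 := (Fact.out : p.Prime).two_le
  have hL : 0 < L := Nat.pos_of_dvd_of_pos hLp (by omega)
  have he0 : ∀ i, 0 < e i := fun i => Nat.pos_of_dvd_of_pos (heL i) hL
  have hep : ∀ i, e i ∣ p - 1 := fun i => (heL i).trans hLp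
  obtain ⟨χ, hχ⟩ := ZMod.exists_mulChar_orderOf_eq p
  have hnorm : ∀ x, ‖χ x‖ ≤ 1 := by
    intro x
    by_cases hx : x = 0
    · rw [hx, MulChar.map_zero, norm_zero]
      exact zero_le_one
    · refine (Complex.norm_eq_one_of_pow_eq_one (n := p - 1) ?_ (by omega)).le
      rw [← map_pow, ZMod.pow_card_sub_one_eq_one hx, map_one]
  set R : ZMod p → ℂ := fun n =>
    ∏ i, ((1 / e i : ℂ) * ∑ j ∈ Finset.range (e i), χ (n - s i) ^ (j * ((p - 1) / e i))) with hR
  set I : ZMod p → ℂ := fun n => if ∀ i, (n - s i) ^ ((p - 1) / e i) = 1 then 1 else 0 with hI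
  have hRI : ∀ n, n ∉ Finset.univ.image s → I n = R n := by
    intro n hn
    have : ∀ i, n - s i ≠ 0 := by
      intro i hi
      exact hn (Finset.mem_image.2 ⟨i, Finset.mem_univ _, (sub_eq_zero.1 hi).symm⟩)
    simp only [hI, hR, MulChar.sum_pow_div_eq_ite hχ (hep _) (this _)]
    rw [Finset.prod_ite_zero]
    simp
  have hI0 : ∀ n, n ∈ Finset.univ.image s → I n = 0 := by
    intro n hn
    obtain ⟨i, -, rfl⟩ := Finset.mem_image.1 hn
    refine if_neg fun h => ?_
    have h := h i
    rw [sub_self, zero_pow] at h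
    · exact zero_ne_one h
    · exact (Nat.div_pos (Nat.le_of_dvd (by omega) (hep i)) (he0 i)).ne'
  have hR1 : ∀ n, ‖R n‖ ≤ 1 := by
    intro n
    rw [hR, norm_prod]
    refine Finset.prod_le_one (fun i _ => norm_nonneg _) fun i _ => ?_
    have hpos : (0 : ℝ) < e i := by exact_mod_cast he0 i
    have h1 : ‖∑ j ∈ Finset.range (e i), χ (n - s i) ^ (j * ((p - 1) / e i))‖ ≤ e i := by
      refine (norm_sum_le _ _).trans ?_
      refine (Finset.sum_le_sum (g := fun _ => (1 : ℝ)) fun j _ => ?_).trans (by simp)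
      rw [norm_pow]
      exact pow_le_one₀ (norm_nonneg _) (hnorm _)
    rw [norm_mul, norm_div, norm_one, Complex.norm_natCast]
    calc 1 / (e i : ℝ) * _ ≤ 1 / (e i : ℝ) * e i := by gcongr
      _ = 1 := by field_simp
  have hdiff : ‖∑ n, I n - ∑ n, R n‖ ≤ Fintype.card ι := by
    rw [← Finset.sum_sub_distrib]
    have : ∑ n, (I n - R n) = ∑ n ∈ Finset.univ.image s, (I n - R n) := by
      symm
      refine Finset.sum_subset (Finset.subset_univ _) fun n _ hn => ?_
      rw [hRI n hn, sub_self]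
    rw [this]
    refine (norm_sum_le _ _).trans ?_
    refine (Finset.sum_le_sum (g := fun _ => (1 : ℝ)) fun n hn => ?_).trans ?_
    · rw [hI0 n hn, zero_sub, norm_neg]
      exact hR1 n
    · rw [Finset.sum_const, nsmul_eq_mul, mul_one]
      exact_mod_cast Finset.card_image_le
  set V : (ι → ℕ) → ℂ := fun x => ∑ n, ∏ i, χ (n - s i) ^ (x i * ((p - 1) / e i)) with hV
  have hRsum : ∑ n, R n = (∏ i, (1 / e i : ℂ)) *
      ∑ x ∈ Fintype.piFinset fun i => Finset.range (e i), V x := by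
    simp only [hR, Finset.prod_mul_distrib, Finset.prod_univ_sum, hV]
    rw [← Finset.mul_sum, Finset.sum_comm]
  have h0mem : (0 : ι → ℕ) ∈ Fintype.piFinset fun i => Finset.range (e i) := by
    simp [Fintype.mem_piFinset, he0]
  have hV0 : V 0 = p := by
    simp [hV, ZMod.card]
  have hVx : ∀ x ∈ (Fintype.piFinset fun i => Finset.range (e i)).erase 0,
      ‖V x‖ ≤ 3 * p / D ^ 2 := by
    intro x hx
    obtain ⟨hx0, hx⟩ := Finset.mem_erase.1 hx
    have hlt : ∀ i, x i < e i := fun i => Finset.mem_range.1 (Fintype.mem_piFinset.1 hx i)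
    have hlt' : ∀ i, x i * ((p - 1) / e i) < p - 1 := by
      intro i
      conv_rhs => rw [← Nat.mul_div_cancel' (hep i)]
      exact Nat.mul_lt_mul_of_pos_right (hlt i)
        (Nat.div_pos (Nat.le_of_dvd (by omega) (hep i)) (he0 i))
    refine MulChar.norm_sum_prod_pow_le_of_orderOf hχ hs (L := L) (fun i => ?_)
      (fun i => (hlt' i).le) ?_ hL hLD hι hp
    · obtain ⟨a, ha⟩ := heL i
      obtain ⟨b, hb⟩ := hep i
      refine ⟨a * x i, ?_⟩
      rw [ha, hb, Nat.mul_div_cancel_left _ (he0 i)]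
      ring
    · obtain ⟨i, hi⟩ := Function.ne_iff.1 hx0
      refine ⟨i, fun h => ?_⟩
      have := Nat.eq_zero_of_dvd_of_lt h (hlt' i)
      rcases Nat.mul_eq_zero.1 this with h1 | h1
      · exact hi h1
      · exact (Nat.div_pos (Nat.le_of_dvd (by omega) (hep i)) (he0 i)).ne' h1
  have hprod : ((∏ i, (1 / e i : ℝ) : ℝ) : ℂ) = ∏ i, (1 / e i : ℂ) := by
    push_cast
    rfl
  have hprodpos : (0 : ℝ) < ∏ i, (1 / e i : ℝ) :=
    Finset.prod_pos fun i _ => by have := he0 i; positivity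
  have hmain : ‖∑ n, R n - ((p * ∏ i, (1 / e i : ℝ) : ℝ) : ℂ)‖ ≤ 3 * p / D ^ 2 := by
    rw [hRsum, ← Finset.add_sum_erase _ _ h0mem, hV0, mul_add, Complex.ofReal_mul,
      Complex.ofReal_natCast, hprod, mul_comm (p : ℂ), add_sub_cancel_left, ← hprod, norm_mul,
      Complex.norm_real, Real.norm_of_nonneg hprodpos.le]
    have h1 : ‖∑ x ∈ (Fintype.piFinset fun i => Finset.range (e i)).erase 0, V x‖ ≤
        (∏ i, (e i : ℝ)) * (3 * p / D ^ 2) := by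
      refine (norm_sum_le _ _).trans ((Finset.sum_le_sum hVx).trans ?_)
      rw [Finset.sum_const, nsmul_eq_mul]
      gcongr
      calc (((Fintype.piFinset fun i => Finset.range (e i)).erase 0).card : ℝ)
          ≤ ((Fintype.piFinset fun i => Finset.range (e i)).card : ℝ) := by
            exact_mod_cast Finset.card_erase_le
        _ = ∏ i, (e i : ℝ) := by
            rw [Fintype.card_piFinset]
            push_cast [Finset.card_range]
            rfl
    calc _ ≤ (∏ i, (1 / e i : ℝ)) * ((∏ i, (e i : ℝ)) * (3 * p / D ^ 2)) := by gcongr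
      _ = 3 * p / D ^ 2 := by
        rw [← mul_assoc, ← Finset.prod_mul_distrib, Finset.prod_eq_one, one_mul]
        intro i _
        have := he0 i
        field_simp
  have hcount : ∑ n, I n = (((Finset.univ.filter fun n : ZMod p =>
      ∀ i, (n - s i) ^ ((p - 1) / e i) = 1).card : ℝ) : ℂ) := by
    simp [hI]
  have htri := norm_add_le (∑ n, I n - ∑ n, R n)
    (∑ n, R n - ((p * ∏ i, (1 / e i : ℝ) : ℝ) : ℂ))
  rw [sub_add_sub_cancel] at htri
  rw [← Real.norm_eq_abs, ← Complex.norm_real, Complex.ofReal_sub, ← hcount]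
  linarith

end Equidistribution

section Sieve
open Finset

/-- The `j`-th elementary symmetric sum of `x` over `I`. -/
def symmSum {α : Type*} (x : α → ℝ) (I : Finset α) (j : ℕ) : ℝ :=
  ∑ J ∈ I.powersetCard j, ∏ i ∈ J, x i

theorem symmSum_zero {α : Type*} (x : α → ℝ) (I : Finset α) : symmSum x I 0 = 1 := by
  simp [symmSum]

theorem symmSum_nonneg {α : Type*} {x : α → ℝ} (hx : ∀ i, 0 ≤ x i) (I : Finset α) (j : ℕ) :
    0 ≤ symmSum x I j :=
  sum_nonneg fun _ _ => prod_nonneg fun i _ => hx i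

theorem symmSum_insert {α : Type*} [DecidableEq α] (x : α → ℝ) {I : Finset α} {a : α} (ha : a ∉ I)
    (j : ℕ) : symmSum x (insert a I) (j + 1) = symmSum x I (j + 1) + x a * symmSum x I j := by
  unfold symmSum
  rw [powersetCard_succ_insert ha, sum_union, sum_image, mul_sum]
  · congr 1
    refine sum_congr rfl fun J hJ => ?_
    rw [prod_insert fun h => ha ((mem_powersetCard.1 hJ).1 h)]
  · intro J hJ K hK h
    have hJ' : a ∉ J := fun h => ha ((mem_powersetCard.1 hJ).1 h)
    have hK' : a ∉ K := fun h => ha ((mem_powersetCard.1 hK).1 h)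
    rw [← erase_insert hJ', ← erase_insert hK', h]
  · rw [disjoint_left]
    intro J hJ hJ'
    obtain ⟨K, -, rfl⟩ := mem_image.1 hJ'
    exact ha ((mem_powersetCard.1 hJ).1 (mem_insert_self a K))

/-- The Bonferroni inequalities. -/
theorem bonferroni {α : Type*} {x : α → ℝ} (hx0 : ∀ i, 0 ≤ x i) (hx1 : ∀ i, x i ≤ 1)
    (I : Finset α) (r : ℕ) :
    0 ≤ (-1) ^ r * (∏ i ∈ I, (1 - x i) - ∑ j ∈ range r, (-1) ^ j * symmSum x I j) ∧
      (-1) ^ r * (∏ i ∈ I, (1 - x i) - ∑ j ∈ range r, (-1) ^ j * symmSum x I j) ≤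
        symmSum x I r := by
  classical
  induction I using Finset.induction_on generalizing r with
  | empty =>
    rcases r with _ | r
    · simp [symmSum]
    · have h0 : ∀ j, symmSum x ∅ (j + 1) = 0 := by
        intro j
        rw [symmSum, powersetCard_eq_empty.2 (by simp), sum_empty]
      rw [sum_range_succ', h0]
      simp [h0, symmSum_zero]
  | insert a I ha ih =>
    rcases r with _ | r
    · have hb : ∀ i ∈ insert a I, 0 ≤ 1 - x i := fun i _ => by linarith [hx1 i]
      have hb' : ∀ i ∈ insert a I, 1 - x i ≤ 1 := fun i _ => by linarith [hx0 i]
      simpa [symmSum_zero, -prod_insert, ha] using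
        (⟨prod_nonneg hb, prod_le_one hb hb'⟩ :
          0 ≤ ∏ i ∈ insert a I, (1 - x i) ∧ ∏ i ∈ insert a I, (1 - x i) ≤ 1)
    · have key : (-1 : ℝ) ^ (r + 1) * (∏ i ∈ insert a I, (1 - x i) -
          ∑ j ∈ range (r + 1), (-1) ^ j * symmSum x (insert a I) j) =
          (-1) ^ (r + 1) * (∏ i ∈ I, (1 - x i) - ∑ j ∈ range (r + 1), (-1) ^ j * symmSum x I j) +
          x a * ((-1) ^ r * (∏ i ∈ I, (1 - x i) - ∑ j ∈ range r, (-1) ^ j * symmSum x I j)) := by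
        have e : ∑ j ∈ range (r + 1), (-1 : ℝ) ^ j * symmSum x (insert a I) j =
            ∑ j ∈ range (r + 1), (-1) ^ j * symmSum x I j -
              x a * ∑ j ∈ range r, (-1) ^ j * symmSum x I j := by
          rw [sum_range_succ', sum_range_succ' (fun j => (-1 : ℝ) ^ j * symmSum x I j) r]
          simp only [symmSum_insert x ha, symmSum_zero, mul_sum]
          rw [add_sub_right_comm, ← sum_sub_distrib]
          congr 1
          refine sum_congr rfl fun j _ => ?_
          ring
        rw [e, prod_insert ha]
        ring
      rw [key, symmSum_insert x ha]
      obtain ⟨h1, h2⟩ := ih (r + 1)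
      obtain ⟨h3, h4⟩ := ih r
      exact ⟨add_nonneg h1 (mul_nonneg (hx0 a) h3),
        add_le_add h2 (mul_le_mul_of_nonneg_left h4 (hx0 a))⟩

theorem abs_prod_sub_le_symmSum {α : Type*} {x : α → ℝ} (hx0 : ∀ i, 0 ≤ x i) (hx1 : ∀ i, x i ≤ 1)
    (I : Finset α) (r : ℕ) :
    |∏ i ∈ I, (1 - x i) - ∑ j ∈ range r, (-1) ^ j * symmSum x I j| ≤ symmSum x I r := by
  obtain ⟨h1, h2⟩ := bonferroni hx0 hx1 I r
  rw [← abs_of_nonneg h1, abs_mul, abs_pow, abs_neg, abs_one, one_pow, one_mul] at h2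
  exact h2

theorem symmSum_le_exp {α : Type*} {x : α → ℝ} (hx0 : ∀ i, 0 ≤ x i) (I : Finset α) (r : ℕ) {B : ℝ}
    (hB : 0 < B) : symmSum x I r ≤ Real.exp (B * ∑ i ∈ I, x i) / B ^ r := by
  classical
  rw [le_div_iff₀ (by positivity), mul_comm]
  calc B ^ r * symmSum x I r = ∑ J ∈ I.powersetCard r, ∏ i ∈ J, (B * x i) := by
        rw [symmSum, mul_sum]
        refine sum_congr rfl fun J hJ => ?_
        rw [prod_mul_distrib, prod_const, (mem_powersetCard.1 hJ).2]
    _ ≤ ∑ J ∈ I.powerset, ∏ i ∈ J, (B * x i) := by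
        refine sum_le_sum_of_subset_of_nonneg (fun J hJ => ?_) fun J _ _ =>
          prod_nonneg fun i _ => mul_nonneg hB.le (hx0 i)
        exact mem_powerset.2 (mem_powersetCard.1 hJ).1
    _ = ∏ i ∈ I, (1 + B * x i) := (prod_one_add I).symm
    _ ≤ ∏ i ∈ I, Real.exp (B * x i) := by
        refine prod_le_prod (fun i _ => ?_) fun i _ => ?_
        · have := mul_nonneg hB.le (hx0 i)
          linarith
        · rw [add_comm]
          exact Real.add_one_le_exp _
    _ = Real.exp (B * ∑ i ∈ I, x i) := by rw [mul_sum, Real.exp_sum]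

theorem sum_choose_le_pow (n r : ℕ) : ∑ j ∈ range (r + 1), n.choose j ≤ (n + 1) ^ r := by
  rw [add_pow]
  refine sum_le_sum fun j hj => ?_
  have hj : j ≤ r := Nat.lt_succ_iff.1 (mem_range.1 hj)
  rw [one_pow, mul_one]
  exact (Nat.choose_le_pow n j).trans (Nat.le_mul_of_pos_right _ (Nat.choose_pos hj))

/-- Brun's pure sieve. -/
theorem abs_card_filter_forall_not_sub_le {Ω α : Type*} [Fintype Ω] (I : Finset α)
    (bad : α → Ω → Prop) [∀ i n, Decidable (bad i n)] {y : α → ℝ} (hy0 : ∀ i, 0 ≤ y i)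
    (hy1 : ∀ i, y i ≤ 1) (r : ℕ) {E : ℝ}
    (hE : ∀ J ⊆ I, J.card ≤ r →
      |((univ.filter fun n => ∀ i ∈ J, bad i n).card : ℝ) - Fintype.card Ω * ∏ i ∈ J, y i| ≤ E) :
    |((univ.filter fun n => ∀ i ∈ I, ¬ bad i n).card : ℝ) -
      Fintype.card Ω * ∏ i ∈ I, (1 - y i)| ≤
        2 * Fintype.card Ω * symmSum y I r + (I.card + 1) ^ r * E := by
  classical
  set x : Ω → α → ℝ := fun n i => if bad i n then 1 else 0 with hx
  have hx0 : ∀ n i, 0 ≤ x n i := fun n i => by simp only [hx]; split_ifs <;> norm_num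
  have hx1 : ∀ n i, x n i ≤ 1 := fun n i => by simp only [hx]; split_ifs <;> norm_num
  have hE0 : 0 ≤ E := (abs_nonneg _).trans (hE ∅ (empty_subset _) (by simp))
  have hc : ∀ j ≤ r, |∑ n, symmSum (x n) I j - Fintype.card Ω * symmSum y I j| ≤
      (I.card.choose j) * E := by
    intro j hj
    unfold symmSum
    rw [sum_comm, mul_sum, ← sum_sub_distrib, ← card_powersetCard, ← nsmul_eq_mul,
      ← sum_const]
    refine (abs_sum_le_sum_abs _ _).trans (sum_le_sum fun J hJ => ?_)
    obtain ⟨hJI, hJc⟩ := mem_powersetCard.1 hJ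
    refine le_of_eq_of_le ?_ (hE J hJI (hJc ▸ hj))
    congr 2
    rw [card_filter, Nat.cast_sum]
    refine sum_congr rfl fun n _ => ?_
    simp only [hx, prod_ite_zero, prod_const_one]
    split_ifs <;> simp
  have hmain : ((univ.filter fun n => ∀ i ∈ I, ¬ bad i n).card : ℝ) =
      ∑ n, ∏ i ∈ I, (1 - x n i) := by
    rw [card_filter, Nat.cast_sum]
    refine sum_congr rfl fun n _ => ?_
    have : ∀ i, 1 - x n i = if ¬ bad i n then 1 else 0 := by
      intro i
      simp only [hx]
      split_ifs <;> norm_num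
    simp only [this, prod_ite_zero, prod_const_one]
    split_ifs <;> simp
  have h1 : |∑ n, ∏ i ∈ I, (1 - x n i) - ∑ j ∈ range r, (-1) ^ j * ∑ n, symmSum (x n) I j| ≤
      ∑ n, symmSum (x n) I r := by
    simp_rw [mul_sum]
    rw [sum_comm, ← sum_sub_distrib]
    exact (abs_sum_le_sum_abs _ _).trans
      (sum_le_sum fun n _ => abs_prod_sub_le_symmSum (hx0 n) (hx1 n) I r)
  have h2 : |Fintype.card Ω * ∏ i ∈ I, (1 - y i) -
      ∑ j ∈ range r, (-1) ^ j * (Fintype.card Ω * symmSum y I j)| ≤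
      Fintype.card Ω * symmSum y I r := by
    have : ∑ j ∈ range r, (-1) ^ j * (Fintype.card Ω * symmSum y I j) =
        Fintype.card Ω * ∑ j ∈ range r, (-1) ^ j * symmSum y I j := by
      rw [mul_sum]
      exact sum_congr rfl fun j _ => by ring
    rw [this, ← mul_sub, abs_mul, Nat.abs_cast]
    exact mul_le_mul_of_nonneg_left (abs_prod_sub_le_symmSum hy0 hy1 I r) (Nat.cast_nonneg _)
  have h3 : |∑ j ∈ range r, (-1) ^ j * ∑ n, symmSum (x n) I j -
      ∑ j ∈ range r, (-1) ^ j * (Fintype.card Ω * symmSum y I j)| ≤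
      ∑ j ∈ range r, (I.card.choose j) * E := by
    rw [← sum_sub_distrib]
    refine (abs_sum_le_sum_abs _ _).trans (sum_le_sum fun j hj => ?_)
    rw [← mul_sub, abs_mul, abs_pow, abs_neg, abs_one, one_pow, one_mul]
    exact hc j (mem_range.1 hj).le
  have h4 := (abs_le.1 (hc r le_rfl)).2
  have h5 : ∑ j ∈ range r, (I.card.choose j : ℝ) * E + (I.card.choose r) * E ≤
      (I.card + 1) ^ r * E := by
    rw [← sum_range_succ, ← sum_mul]
    refine mul_le_mul_of_nonneg_right ?_ hE0
    exact_mod_cast sum_choose_le_pow I.card r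
  rw [hmain]
  rw [abs_le] at h1 h2 h3 ⊢
  constructor <;> linarith

end Sieve

section PrimitiveShifts
open Finset

variable {p : ℕ} [Fact p.Prime]

theorem pow_div_prod_eq_one {G : Type*} [Monoid G] {N : ℕ} (hN : 0 < N) {x : G} (hx : x ^ N = 1)
    {A : Finset ℕ} (hA : ∀ q ∈ A, q.Prime) (hAN : ∀ q ∈ A, q ∣ N)
    (h : ∀ q ∈ A, x ^ (N / q) = 1) : x ^ (N / ∏ q ∈ A, q) = 1 := by
  obtain ⟨b, hb⟩ := orderOf_dvd_of_pow_eq_one hx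
  have ho : 0 < orderOf x := Nat.pos_of_dvd_of_pos ⟨b, hb⟩ hN
  have hdvd : ∏ q ∈ A, q ∣ b := by
    refine Finset.prod_primes_dvd b (fun q hq => (hA q hq).prime) fun q hq => ?_
    obtain ⟨c, hc⟩ := orderOf_dvd_of_pow_eq_one (h q hq)
    have : N = orderOf x * (q * c) := by
      rw [← Nat.mul_div_cancel' (hAN q hq), hc]
      ring
    rw [hb] at this
    exact ⟨c, Nat.eq_of_mul_eq_mul_left ho this⟩
  obtain ⟨c, hc⟩ := hdvd
  have hA0 : 0 < ∏ q ∈ A, q := Finset.prod_pos fun q hq => (hA q hq).pos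
  refine orderOf_dvd_iff_pow_eq_one.1 ⟨c, ?_⟩
  refine Nat.div_eq_of_eq_mul_right hA0 ?_
  rw [hb, hc]
  ring

theorem ZMod.orderOf_eq_sub_one_iff {x : ZMod p} (hx : x ≠ 0) :
    orderOf x = p - 1 ↔ ∀ q ∈ (p - 1).primeFactors, x ^ ((p - 1) / q) ≠ 1 := by
  have hp2 := (Fact.out : p.Prime).two_le
  constructor
  · intro h q hq h1
    have hq' := Nat.prime_of_mem_primeFactors hq
    have h2 := orderOf_dvd_of_pow_eq_one h1
    rw [h] at h2
    have h3 := Nat.le_of_dvd (Nat.div_pos (Nat.le_of_dvd (by omega)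
      (Nat.dvd_of_mem_primeFactors hq)) hq'.pos) h2
    exact absurd (Nat.div_lt_self (by omega : 0 < p - 1) hq'.one_lt) (by omega)
  · intro h
    refine orderOf_eq_of_pow_and_pow_div_prime (by omega) (ZMod.pow_card_sub_one_eq_one hx) ?_
    intro q hq hqd
    exact h q (Nat.mem_primeFactors.2 ⟨hq, hqd, by omega⟩)

theorem card_filter_le_card_filter_add {α : Type*} [Fintype α] [DecidableEq α] {P Q : α → Prop}
    [DecidablePred P] [DecidablePred Q] {S : Finset α} (h : ∀ n, P n → n ∉ S → Q n) :
    (univ.filter P).card ≤ (univ.filter Q).card + S.card := by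
  refine (card_le_card fun n hn => ?_).trans (card_union_le _ _)
  rw [mem_union]
  by_cases hS : n ∈ S
  · exact Or.inr hS
  · exact Or.inl (mem_filter.2 ⟨mem_univ _, h n (mem_filter.1 hn).2 hS⟩)

/-- Joint equidistribution of finitely many prime residue conditions. -/
theorem ZMod.abs_card_forall_mem_pow_div_sub_le {S : Finset (ZMod p)} {Q : Finset ℕ}
    (hQ : Q ⊆ (p - 1).primeFactors) {z r D : ℕ} (hz : ∀ q ∈ Q, q ≤ z) (hz1 : 1 ≤ z)
    (hD : z ^ r ≤ D) (hS : S.card ≤ D) (hp : 6 * D ^ 13 < p) {J : Finset (ℕ × ZMod p)}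
    (hJ : J ⊆ Q ×ˢ S) (hJr : J.card ≤ r) :
    |((univ.filter fun n : ZMod p => ∀ i ∈ J, (n - i.2) ^ ((p - 1) / i.1) = 1).card : ℝ) -
      p * ∏ i ∈ J, (1 / i.1 : ℝ)| ≤ 2 * S.card + 3 * p / D ^ 2 := by
  have hp2 := (Fact.out : p.Prime).two_le
  have hJQ : ∀ i ∈ J, i.1 ∈ Q := fun i hi => (mem_product.1 (hJ hi)).1
  have hJS : ∀ i ∈ J, i.2 ∈ S := fun i hi => (mem_product.1 (hJ hi)).2
  have hprime : ∀ q ∈ Q, q.Prime := fun q hq => Nat.prime_of_mem_primeFactors (hQ hq)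
  have hdvd : ∀ q ∈ Q, q ∣ p - 1 := fun q hq => Nat.dvd_of_mem_primeFactors (hQ hq)
  set A : ZMod p → Finset ℕ := fun s => (J.filter fun i => i.2 = s).image Prod.fst with hA
  have hAJ : ∀ s, A s ⊆ J.image Prod.fst := fun s => image_subset_image (filter_subset _ _)
  have hJimg : ∀ q ∈ J.image Prod.fst, q ∈ Q := by
    intro q hq
    obtain ⟨i, hi, rfl⟩ := mem_image.1 hq
    exact hJQ i hi
  have hmemA : ∀ s q, q ∈ A s ↔ (q, s) ∈ J := by
    intro s q
    simp [hA]
  have hL : ∏ q ∈ J.image Prod.fst, q ≤ D := by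
    refine le_trans ?_ hD
    refine (prod_le_pow_card _ _ z fun q hq => hz q (hJimg q hq)).trans ?_
    exact Nat.pow_le_pow_right hz1 (card_image_le.trans hJr)
  have key := ZMod.abs_card_forall_pow_div_eq_one_sub_le (p := p) (ι := S)
    (s := Subtype.val) Subtype.val_injective (e := fun s => ∏ q ∈ A s, q)
    (L := ∏ q ∈ J.image Prod.fst, q) (D := D)
    (fun s => prod_dvd_prod_of_subset _ _ _ (hAJ s))
    (prod_primes_dvd _ (fun q hq => (hprime q (hJimg q hq)).prime)
      fun q hq => hdvd q (hJimg q hq)) hL (by simpa using hS) hp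
  have hprod : ∏ s : S, (1 / ((∏ q ∈ A s, q : ℕ) : ℝ)) = ∏ i ∈ J, (1 / i.1 : ℝ) := by
    rw [prod_coe_sort S fun s => (1 / ((∏ q ∈ A s, q : ℕ) : ℝ)), ← prod_fiberwise_of_maps_to hJS]
    refine prod_congr rfl fun s _ => ?_
    simp only [hA]
    rw [prod_image, Nat.cast_prod, one_div, ← prod_inv_distrib]
    · simp
    · intro i hi j hj hij
      have hi' := (mem_filter.1 hi).2
      have hj' := (mem_filter.1 hj).2
      exact Prod.ext hij (hi'.trans hj'.symm)
  rw [hprod, Fintype.card_coe] at key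
  have h1 : (univ.filter fun n : ZMod p =>
      ∀ s : S, (n - s) ^ ((p - 1) / ∏ q ∈ A s, q) = 1).card ≤
      (univ.filter fun n : ZMod p => ∀ i ∈ J, (n - i.2) ^ ((p - 1) / i.1) = 1).card := by
    refine card_le_card (monotone_filter_right _ fun n _ hn i hi => ?_)
    have hiA : i.1 ∈ A i.2 := (hmemA _ _).2 hi
    have hAd : ∏ q ∈ A i.2, q ∣ p - 1 :=
      prod_primes_dvd _ (fun q hq => (hprime q (hJimg q (hAJ _ hq))).prime)
        fun q hq => hdvd q (hJimg q (hAJ _ hq))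
    obtain ⟨b, hb⟩ := hAd
    obtain ⟨c, hc⟩ := dvd_prod_of_mem (fun q => q) hiA
    have h := hn ⟨i.2, hJS i hi⟩
    simp only at h
    have hA0 : 0 < ∏ q ∈ A i.2, q := Nat.pos_of_dvd_of_pos ⟨b, hb⟩ (by omega)
    rw [hb, Nat.mul_div_cancel_left _ hA0] at h
    have hi0 : 0 < i.1 := (hprime _ (hJQ i hi)).pos
    rw [hb, hc, mul_assoc, Nat.mul_div_cancel_left _ hi0, mul_comm, pow_mul, h, one_pow]
  have h2 : (univ.filter fun n : ZMod p => ∀ i ∈ J, (n - i.2) ^ ((p - 1) / i.1) = 1).card ≤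
      (univ.filter fun n : ZMod p =>
        ∀ s : S, (n - s) ^ ((p - 1) / ∏ q ∈ A s, q) = 1).card + S.card := by
    refine card_filter_le_card_filter_add fun n hn hnS s => ?_
    have hns : n - s ≠ 0 := fun h => hnS (by rw [sub_eq_zero.1 h]; exact s.2)
    exact pow_div_prod_eq_one (by omega) (ZMod.pow_card_sub_one_eq_one hns)
      (fun q hq => hprime q (hJimg q (hAJ _ hq))) (fun q hq => hdvd q (hJimg q (hAJ _ hq)))
      fun q hq => hn (q, s) ((hmemA _ _).1 hq)
  have h1' : ((univ.filter fun n : ZMod p =>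
      ∀ s : S, (n - s) ^ ((p - 1) / ∏ q ∈ A s, q) = 1).card : ℝ) ≤
      (univ.filter fun n : ZMod p => ∀ i ∈ J, (n - i.2) ^ ((p - 1) / i.1) = 1).card := by
    exact_mod_cast h1
  have h2' : ((univ.filter fun n : ZMod p => ∀ i ∈ J, (n - i.2) ^ ((p - 1) / i.1) = 1).card : ℝ) ≤
      (univ.filter fun n : ZMod p =>
        ∀ s : S, (n - s) ^ ((p - 1) / ∏ q ∈ A s, q) = 1).card + S.card := by
    exact_mod_cast h2
  rw [abs_le] at key ⊢
  constructor <;> linarith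

theorem card_filter_forall_primitive_le (S : Finset (ZMod p)) (z : ℕ) :
    (univ.filter fun n : ZMod p => ∀ s ∈ S, orderOf (n - s) = p - 1).card ≤
      (univ.filter fun n : ZMod p => ∀ i ∈ ((p - 1).primeFactors.filter (· ≤ z)) ×ˢ S,
        ¬ (n - i.2) ^ ((p - 1) / i.1) = 1).card := by
  have hp2 := (Fact.out : p.Prime).two_le
  refine card_le_card (monotone_filter_right _ fun n _ hn i hi => ?_)
  obtain ⟨h1, h2⟩ := mem_product.1 hi
  have h := hn i.2 h2
  by_cases h0 : n - i.2 = 0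
  · have hq := (mem_filter.1 h1).1
    rw [h0, zero_pow]
    · exact zero_ne_one
    · exact (Nat.div_pos (Nat.le_of_dvd (by omega) (Nat.dvd_of_mem_primeFactors hq))
        (Nat.prime_of_mem_primeFactors hq).pos).ne'
  · exact (ZMod.orderOf_eq_sub_one_iff h0).1 h i.1 (mem_filter.1 h1).1

theorem card_filter_forall_not_le (S : Finset (ZMod p)) {z : ℕ} (hz : 1 ≤ z) :
    ((univ.filter fun n : ZMod p => ∀ i ∈ ((p - 1).primeFactors.filter (· ≤ z)) ×ˢ S,
        ¬ (n - i.2) ^ ((p - 1) / i.1) = 1).card : ℝ) ≤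
      (univ.filter fun n : ZMod p => ∀ s ∈ S, orderOf (n - s) = p - 1).card +
        S.card + S.card * (p - 1).primeFactors.card * p / z := by
  have hp2 := (Fact.out : p.Prime).two_le
  set X := (((p - 1).primeFactors.filter (z < ·)) ×ˢ S).biUnion fun i =>
    univ.filter fun n : ZMod p => (n - i.2) ^ ((p - 1) / i.1) = 1 with hX
  have h1 := card_filter_le_card_filter_add (S := S ∪ X)
    (P := fun n : ZMod p => ∀ i ∈ ((p - 1).primeFactors.filter (· ≤ z)) ×ˢ S,
        ¬ (n - i.2) ^ ((p - 1) / i.1) = 1)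
    (Q := fun n : ZMod p => ∀ s ∈ S, orderOf (n - s) = p - 1) (by
      intro n hn hnS s hs
      rw [mem_union, not_or] at hnS
      have hns : n - s ≠ 0 := fun h => hnS.1 (by rw [sub_eq_zero.1 h]; exact hs)
      rw [ZMod.orderOf_eq_sub_one_iff hns]
      intro q hq h
      by_cases hqz : q ≤ z
      · exact hn (q, s) (mem_product.2 ⟨mem_filter.2 ⟨hq, hqz⟩, hs⟩) h
      · refine hnS.2 (mem_biUnion.2 ⟨(q, s), mem_product.2 ⟨mem_filter.2 ⟨hq, ?_⟩, hs⟩, ?_⟩)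
        · omega
        · exact mem_filter.2 ⟨mem_univ _, h⟩)
  have h2 : (X.card : ℝ) ≤ S.card * (p - 1).primeFactors.card * p / z := by
    have hz0 : (0 : ℝ) < z := by exact_mod_cast hz
    calc (X.card : ℝ) ≤ ∑ i ∈ ((p - 1).primeFactors.filter (z < ·)) ×ˢ S,
          ((univ.filter fun n : ZMod p => (n - i.2) ^ ((p - 1) / i.1) = 1).card : ℝ) := by
            exact_mod_cast card_biUnion_le
      _ ≤ ∑ i ∈ ((p - 1).primeFactors.filter (z < ·)) ×ˢ S, (p / z : ℝ) := by
            refine sum_le_sum fun i hi => ?_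
            obtain ⟨hq, hzq⟩ := mem_filter.1 (mem_product.1 hi).1
            have hcard : (univ.filter fun n : ZMod p => (n - i.2) ^ ((p - 1) / i.1) = 1).card =
                (p - 1) / i.1 := by
              conv_rhs => rw [← ZMod.card_pow_eq_one
                (Nat.mul_div_cancel' (Nat.dvd_of_mem_primeFactors hq))]
              refine card_bij' (fun n _ => n - i.2) (fun n _ => n + i.2) ?_ ?_ ?_ ?_
              · intro n hn
                simpa using hn
              · intro n hn
                simpa using hn
              · intro n _
                exact sub_add_cancel n i.2
              · intro n _
                exact add_sub_cancel_right n i.2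
            rw [hcard]
            refine Nat.cast_div_le.trans ?_
            have : (z : ℝ) ≤ i.1 := by exact_mod_cast hzq.le
            gcongr
            omega
      _ ≤ ((p - 1).primeFactors.card * S.card : ℕ) * (p / z : ℝ) := by
            rw [sum_const, nsmul_eq_mul, card_product]
            gcongr
            exact filter_subset _ _
      _ = S.card * (p - 1).primeFactors.card * p / z := by
            push_cast
            ring
  have h3 : ((S ∪ X).card : ℝ) ≤ S.card + X.card := by exact_mod_cast card_union_le _ _
  have h4 : ((univ.filter fun n : ZMod p => ∀ i ∈ ((p - 1).primeFactors.filter (· ≤ z)) ×ˢ S,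
        ¬ (n - i.2) ^ ((p - 1) / i.1) = 1).card : ℝ) ≤
      (univ.filter fun n : ZMod p => ∀ s ∈ S, orderOf (n - s) = p - 1).card + (S ∪ X).card := by
    exact_mod_cast h1
  linarith

theorem one_sub_sum_le_prod_one_sub {ι : Type*} (s : Finset ι) {x : ι → ℝ} (h0 : ∀ i ∈ s, 0 ≤ x i)
    (h1 : ∀ i ∈ s, x i ≤ 1) : 1 - ∑ i ∈ s, x i ≤ ∏ i ∈ s, (1 - x i) := by
  classical
  induction s using Finset.induction_on with
  | empty => simp
  | insert a s ha ih =>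
    rw [sum_insert ha, prod_insert ha]
    have h := ih (fun i hi => h0 i (mem_insert_of_mem hi)) fun i hi => h1 i (mem_insert_of_mem hi)
    have ha0 := h0 a (mem_insert_self a s)
    have ha1 := h1 a (mem_insert_self a s)
    have hs : 0 ≤ ∑ i ∈ s, x i := sum_nonneg fun i hi => h0 i (mem_insert_of_mem hi)
    nlinarith

end PrimitiveShifts

section PrimitiveShiftsCount
open Finset

theorem one_div_natCast_le_one (q : ℕ) : (1 / q : ℝ) ≤ 1 := by
  simpa using Nat.cast_inv_le_one (α := ℝ) q

variable {p : ℕ} [Fact p.Prime]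

theorem abs_prod_pow_sub_totient_pow_le {z : ℕ} (hz : 1 ≤ z) (k : ℕ) :
    |(∏ q ∈ (p - 1).primeFactors.filter (· ≤ z), (1 - 1 / q : ℝ)) ^ k -
      ((p - 1).totient / p : ℝ) ^ k| ≤ k * ((p - 1).primeFactors.card / z + 1 / p) := by
  have hp2 := (Fact.out : p.Prime).two_le
  have hq0 : ∀ q : ℕ, (0 : ℝ) ≤ 1 - 1 / q := by
    intro q
    rw [sub_nonneg]
    exact one_div_natCast_le_one q
  have hq1 : ∀ q : ℕ, (1 - 1 / q : ℝ) ≤ 1 := by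
    intro q
    have : (0 : ℝ) ≤ 1 / q := by positivity
    linarith
  set a := ∏ q ∈ (p - 1).primeFactors.filter (· ≤ z), (1 - 1 / q : ℝ) with ha
  set b := ∏ q ∈ (p - 1).primeFactors.filter (¬ · ≤ z), (1 - 1 / q : ℝ) with hb
  have hab : ((p - 1).totient : ℝ) = (p - 1) * (a * b) := by
    have h := Nat.totient_eq_mul_prod_factors (p - 1)
    have h' : (((p - 1).totient : ℚ) : ℝ) =
        (((p - 1 : ℕ) : ℚ) * ∏ q ∈ (p - 1).primeFactors, (1 - (q : ℚ)⁻¹) : ℚ) := by rw [h]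
    rw [ha, hb, prod_filter_mul_prod_filter_not]
    push_cast [Nat.cast_sub (by omega : 1 ≤ p)] at h'
    simpa [one_div] using h'
  have ha0 : 0 ≤ a := prod_nonneg fun q _ => hq0 q
  have ha1 : a ≤ 1 := prod_le_one (fun q _ => hq0 q) fun q _ => hq1 q
  have hb0 : 0 ≤ b := prod_nonneg fun q _ => hq0 q
  have hb1 : b ≤ 1 := prod_le_one (fun q _ => hq0 q) fun q _ => hq1 q
  have hz0 : (0 : ℝ) < z := by exact_mod_cast hz
  have hp0 : (0 : ℝ) < p := by exact_mod_cast (by omega : 0 < p)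
  have hb2 : 1 - ((p - 1).primeFactors.card : ℝ) / z ≤ b := by
    refine le_trans ?_ (one_sub_sum_le_prod_one_sub _ (fun q _ => by positivity)
      fun q _ => one_div_natCast_le_one q)
    rw [sub_le_sub_iff_left]
    calc ∑ q ∈ (p - 1).primeFactors.filter (¬ · ≤ z), (1 / q : ℝ)
        ≤ ∑ q ∈ (p - 1).primeFactors.filter (¬ · ≤ z), (1 / z : ℝ) := by
          refine sum_le_sum fun q hq => ?_
          have : (z : ℝ) ≤ q := by exact_mod_cast (not_le.1 (mem_filter.1 hq).2).le
          gcongr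
      _ ≤ ((p - 1).primeFactors.card : ℝ) * (1 / z) := by
          rw [sum_const, nsmul_eq_mul]
          gcongr
          exact filter_subset _ _
      _ = _ := by ring
  set η : ℝ := (p - 1).totient / p with hη
  have hηeq : η = (1 - 1 / p) * (a * b) := by
    rw [hη, hab]
    field_simp
  have hp1 : (0 : ℝ) ≤ 1 - 1 / p := hq0 p
  have hp1' : (1 : ℝ) - 1 / p ≤ 1 := hq1 p
  have hab1 : a * b ≤ a := by nlinarith
  have hab0 : 0 ≤ a * b := mul_nonneg ha0 hb0
  have hη0 : 0 ≤ η := by rw [hηeq]; exact mul_nonneg hp1 hab0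
  have hηa : η ≤ a := by rw [hηeq]; nlinarith
  have hω : 0 ≤ ((p - 1).primeFactors.card : ℝ) / z := by positivity
  have hip : (0 : ℝ) ≤ 1 / p := by positivity
  have hdiff : a - η ≤ (p - 1).primeFactors.card / z + 1 / p := by
    have h1 : a - a * b ≤ (p - 1).primeFactors.card / z := by nlinarith
    have h2 : a * b - η ≤ 1 / p := by rw [hηeq]; nlinarith
    linarith
  have habs : |a - η| ≤ (p - 1).primeFactors.card / z + 1 / p := by
    rw [abs_of_nonneg (by linarith)]
    exact hdiff
  refine (abs_pow_sub_pow_le a η k).trans ?_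
  have hmax : max |a| |η| ^ (k - 1) ≤ 1 := by
    refine pow_le_one₀ (le_max_of_le_left (abs_nonneg _)) (max_le ?_ ?_)
    · rw [abs_of_nonneg ha0]; exact ha1
    · rw [abs_of_nonneg hη0]; linarith
  calc |a - η| * k * max |a| |η| ^ (k - 1) ≤ |a - η| * k * 1 := by gcongr
    _ ≤ k * ((p - 1).primeFactors.card / z + 1 / p) := by
      rw [mul_one, mul_comm]
      gcongr

/-- The number of shifts making all of `n - s`, `s ∈ S`, primitive roots. -/
theorem abs_card_forall_primitive_sub_le (S : Finset (ZMod p)) {z r D : ℕ} (hz : 1 ≤ z)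
    (hD : z ^ r ≤ D) (hS : S.card ≤ D) (hp : 6 * D ^ 13 < p) {B : ℝ} (hB : 0 < B) :
    |((univ.filter fun n : ZMod p => ∀ s ∈ S, orderOf (n - s) = p - 1).card : ℝ) -
      p * ((p - 1).totient / p : ℝ) ^ S.card| ≤
      2 * p * (Real.exp (B * (S.card * ∑ q ∈ (p - 1).primeFactors, (1 / q : ℝ))) / B ^ r) +
      ((p - 1).primeFactors.card * S.card + 1) ^ r * (2 * S.card + 3 * p / D ^ 2) +
      (2 * S.card + 2 * (S.card * (p - 1).primeFactors.card * p / z)) := by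
  have hp2 := (Fact.out : p.Prime).two_le
  have hp0 : (0 : ℝ) < p := by exact_mod_cast (by omega : 0 < p)
  set Q := (p - 1).primeFactors.filter (· ≤ z) with hQ
  set y : ℕ × ZMod p → ℝ := fun i => 1 / i.1 with hy
  have hy0 : ∀ i, 0 ≤ y i := fun i => by simp only [hy]; positivity
  have h1 := abs_card_filter_forall_not_sub_le (Ω := ZMod p) (Q ×ˢ S)
    (fun i n => (n - i.2) ^ ((p - 1) / i.1) = 1) (y := y) hy0
    (fun i => one_div_natCast_le_one i.1) r (E := 2 * S.card + 3 * p / D ^ 2) (by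
      intro J hJ hJr
      rw [ZMod.card]
      exact ZMod.abs_card_forall_mem_pow_div_sub_le (filter_subset _ _)
        (fun q hq => (mem_filter.1 hq).2) hz hD hS hp hJ hJr)
  have hprod : ∏ i ∈ Q ×ˢ S, (1 - y i) = (∏ q ∈ Q, (1 - 1 / q : ℝ)) ^ S.card := by
    rw [prod_product, ← prod_pow]
    exact prod_congr rfl fun q _ => by simp [hy]
  have hsum : ∑ i ∈ Q ×ˢ S, y i ≤ S.card * ∑ q ∈ (p - 1).primeFactors, (1 / q : ℝ) := by
    rw [sum_product]
    simp only [hy, sum_const, nsmul_eq_mul]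
    rw [← mul_sum]
    gcongr
    exact filter_subset _ _
  have he : symmSum y (Q ×ˢ S) r ≤
      Real.exp (B * (S.card * ∑ q ∈ (p - 1).primeFactors, (1 / q : ℝ))) / B ^ r := by
    refine (symmSum_le_exp hy0 _ r hB).trans ?_
    gcongr
  have hcard : (((Q ×ˢ S).card : ℝ) + 1) ^ r ≤ ((p - 1).primeFactors.card * S.card + 1) ^ r := by
    rw [card_product, Nat.cast_mul]
    gcongr
    exact filter_subset _ _
  rw [ZMod.card, hprod] at h1
  have h2 := abs_prod_pow_sub_totient_pow_le (p := p) hz S.card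
  have h3 : ((univ.filter fun n : ZMod p => ∀ s ∈ S, orderOf (n - s) = p - 1).card : ℝ) ≤
      (univ.filter fun n : ZMod p => ∀ i ∈ Q ×ˢ S, ¬ (n - i.2) ^ ((p - 1) / i.1) = 1).card := by
    exact_mod_cast card_filter_forall_primitive_le S z
  have h4 := card_filter_forall_not_le S hz
  have h5 : |(p : ℝ) * (∏ q ∈ Q, (1 - 1 / q : ℝ)) ^ S.card -
      p * ((p - 1).totient / p : ℝ) ^ S.card| ≤
      S.card * (p - 1).primeFactors.card * p / z + S.card := by
    rw [← mul_sub, abs_mul, abs_of_pos hp0]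
    calc (p : ℝ) * _ ≤ p * (S.card * ((p - 1).primeFactors.card / z + 1 / p)) := by gcongr
      _ = _ := by field_simp
  have h6 : 2 * (p : ℝ) * symmSum y (Q ×ˢ S) r + (((Q ×ˢ S).card : ℝ) + 1) ^ r *
      (2 * S.card + 3 * p / D ^ 2) ≤
      2 * p * (Real.exp (B * (S.card * ∑ q ∈ (p - 1).primeFactors, (1 / q : ℝ))) / B ^ r) +
      ((p - 1).primeFactors.card * S.card + 1) ^ r * (2 * S.card + 3 * p / D ^ 2) := by
    gcongr
  rw [abs_le] at h1 h5 ⊢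
  constructor <;> linarith

end PrimitiveShiftsCount

section Patterns
open Finset

/-- Inclusion–exclusion: joint frequencies of the `P s` determine those with negations. -/
theorem abs_card_filter_and_not_sub_le {Ω α : Type*} [Fintype Ω] [DecidableEq α]
    {P : α → Ω → Prop} [∀ s n, Decidable (P s n)] {K : ℕ} {X η E : ℝ}
    (hE : ∀ S : Finset α, S.card ≤ K →
      |((univ.filter fun n => ∀ s ∈ S, P s n).card : ℝ) - X * η ^ S.card| ≤ E)
    (B A : Finset α) (hAB : Disjoint A B) (hK : A.card + B.card ≤ K) :
    |((univ.filter fun n => (∀ s ∈ A, P s n) ∧ ∀ s ∈ B, ¬ P s n).card : ℝ) -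
      X * (η ^ A.card * (1 - η) ^ B.card)| ≤ 2 ^ B.card * E := by
  induction B using Finset.induction_on generalizing A with
  | empty => simpa using hE A (by simpa using hK)
  | insert b B hb ih =>
    rw [disjoint_insert_right] at hAB
    rw [card_insert_of_notMem hb] at hK ⊢
    have h1 := ih A hAB.2 (by omega)
    have h2 := ih (insert b A) (disjoint_insert_left.2 ⟨hb, hAB.2⟩)
      (by rw [card_insert_of_notMem hAB.1]; omega)
    rw [card_insert_of_notMem hAB.1] at h2
    have h3 : (univ.filter fun n => (∀ s ∈ A, P s n) ∧ ∀ s ∈ B, ¬ P s n).card =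
        (univ.filter fun n => (∀ s ∈ insert b A, P s n) ∧ ∀ s ∈ B, ¬ P s n).card +
        (univ.filter fun n => (∀ s ∈ A, P s n) ∧ ∀ s ∈ insert b B, ¬ P s n).card := by
      rw [← card_filter_add_card_filter_not (fun n => P b n), filter_filter, filter_filter]
      congr 2
      · refine filter_congr fun n _ => ?_
        rw [forall_mem_insert]
        tauto
      · refine filter_congr fun n _ => ?_
        rw [forall_mem_insert]
        tauto
    have h4 : ((univ.filter fun n => (∀ s ∈ A, P s n) ∧ ∀ s ∈ insert b B, ¬ P s n).card : ℝ) -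
        X * (η ^ A.card * (1 - η) ^ (B.card + 1)) =
        (((univ.filter fun n => (∀ s ∈ A, P s n) ∧ ∀ s ∈ B, ¬ P s n).card : ℝ) -
          X * (η ^ A.card * (1 - η) ^ B.card)) -
        (((univ.filter fun n => (∀ s ∈ insert b A, P s n) ∧ ∀ s ∈ B, ¬ P s n).card : ℝ) -
          X * (η ^ (A.card + 1) * (1 - η) ^ B.card)) := by
      rw [h3]
      push_cast
      ring
    rw [h4]
    refine (abs_sub _ _).trans ?_
    have h5 : (2 : ℝ) ^ (B.card + 1) * E = 2 ^ B.card * E + 2 ^ B.card * E := by ring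
    rw [h5]
    exact add_le_add h1 h2

/-- In a strictly increasing list, a member following `l[m]` with no member strictly in between is
`l[m + 1]`. -/
theorem List.SortedLT.getElem_succ_eq {l : List ℕ} (hl : l.SortedLT) {m y : ℕ} (hm : m < l.length)
    (hy : y ∈ l) (hlt : l[m] < y) (hbtw : ∀ x ∈ l, l[m] < x → y ≤ x) :
    ∃ h : m + 1 < l.length, l[m + 1] = y := by
  obtain ⟨m', hm', rfl⟩ := List.mem_iff_getElem.1 hy
  have hmono := hl.strictMono_get
  have h1 : m < m' := by
    by_contra! h
    have := hmono.monotone (show (⟨m', hm'⟩ : Fin l.length) ≤ ⟨m, hm⟩ from h)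
    simp only [List.get_eq_getElem] at this
    omega
  have h : m + 1 < l.length := by omega
  refine ⟨h, le_antisymm ?_ (hbtw _ (List.getElem_mem h) ?_)⟩
  · exact hmono.monotone (show (⟨m + 1, h⟩ : Fin l.length) ≤ ⟨m', hm'⟩ from h1)
  · exact hmono (show (⟨m, hm⟩ : Fin l.length) < ⟨m + 1, h⟩ from Nat.lt_succ_self m)

variable {p : ℕ}

theorem mem_primRootsList {x : ℕ} :
    x ∈ primRootsList p ↔ (1 ≤ x ∧ x < p) ∧ orderOf (x : ZMod p) = p - 1 := by
  rw [primRootsList, Finset.mem_sort, mem_filter, mem_Ico]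

theorem sortedLT_primRootsList : (primRootsList p).SortedLT :=
  Finset.sortedLT_sort _

theorem length_primRootsList [Fact p.Prime] :
    (primRootsList p).length = (p - 1).totient := by
  have hcyc := IsCyclic.card_orderOf_eq_totient (α := (ZMod p)ˣ) (d := p - 1)
    (by rw [ZMod.card_units_eq_totient, Nat.totient_prime Fact.out])
  rw [primRootsList, Finset.length_sort, ← hcyc]
  symm
  refine card_bij (fun u _ => (u : ZMod p).val) ?_ ?_ ?_
  · intro u hu
    rw [mem_filter] at hu
    rw [mem_filter, mem_Ico, ZMod.natCast_zmod_val, orderOf_units]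
    refine ⟨⟨?_, ZMod.val_lt _⟩, hu.2⟩
    rw [Nat.one_le_iff_ne_zero, Ne, ZMod.val_eq_zero]
    exact u.ne_zero
  · intro u _ v _ h
    exact Units.ext (ZMod.val_injective p h)
  · intro x hx
    obtain ⟨hx1, hx2⟩ := mem_filter.1 hx
    rw [mem_Ico] at hx1
    have h0 : (x : ZMod p) ≠ 0 := by
      intro h
      rw [ZMod.natCast_eq_zero_iff] at h
      have := Nat.le_of_dvd (by omega) h
      omega
    refine ⟨Units.mk0 (x : ZMod p) h0, ?_, ?_⟩
    · rw [mem_filter, ← orderOf_units]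
      exact ⟨mem_univ _, hx2⟩
    · rw [Units.val_mk0, ZMod.val_natCast_of_lt hx1.2]

end Patterns

section PatternCount
open Finset

/-- If `x = l[m]` and the members of a strictly increasing list lying in `[x, x + t k]` are exactly
the `x + t i`, then these are the consecutive entries `l[m], …, l[m + k]`. -/
theorem List.SortedLT.getElem_add_eq {l : List ℕ} (hl : l.SortedLT) {t : ℕ → ℕ} (ht : StrictMono t)
    (ht0 : t 0 = 0) {m k x : ℕ} (hm : m < l.length) (hx : l[m] = x)
    (hmem : ∀ i ≤ k, x + t i ∈ l) (hnot : ∀ u ≤ t k, (∀ i ≤ k, u ≠ t i) → x + u ∉ l) :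
    ∀ i ≤ k, ∃ h : m + i < l.length, l[m + i] = x + t i := by
  intro i
  induction i with
  | zero => exact fun _ => ⟨hm, by simp [hx, ht0]⟩
  | succ i ih =>
    intro hi
    obtain ⟨h, hval⟩ := ih (by omega)
    have hlt : t i < t (i + 1) := ht (Nat.lt_succ_self i)
    refine hl.getElem_succ_eq (m := m + i) h (hmem _ hi) (by omega) fun y hy hxy => ?_
    by_contra! hlt2
    have h1 : t (i + 1) ≤ t k := ht.monotone hi
    refine hnot (y - x) (by omega) (fun j _ hj => ?_) ?_
    · have h2 : t i < t j := by omega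
      have h3 : t j < t (i + 1) := by omega
      have := ht.lt_iff_lt.1 h2
      have := ht.lt_iff_lt.1 h3
      omega
    · rwa [show x + (y - x) = y by omega]

variable {p : ℕ} [Fact p.Prime]

theorem mem_primRootsList_iff_of_lt {x : ℕ} (hx : x < p) :
    x ∈ primRootsList p ↔ orderOf (x : ZMod p) = p - 1 := by
  rw [mem_primRootsList, and_iff_right_iff_imp]
  intro h
  refine ⟨Nat.one_le_iff_ne_zero.2 ?_, hx⟩
  rintro rfl
  have hp2 := (Fact.out : p.Prime).two_le
  have h0 : orderOf ((0 : ℕ) : ZMod p) = 0 := by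
    rw [orderOf_eq_zero_iff']
    intro n hn
    rw [Nat.cast_zero, zero_pow hn.ne']
    exact zero_ne_one
  omega

/-- The positions in the list of primitive roots at which the gap sums are `t 1, …, t k`. -/
noncomputable def gapPositions (p : ℕ) (t : ℕ → ℕ) (k : ℕ) : Finset ℕ :=
  (range ((p - 1).totient - k)).filter fun n =>
    ∀ i ≤ k, (primRootsList p).getD (n + i) 0 = (primRootsList p).getD n 0 + t i

open scoped Classical in
theorem card_filter_gaps_le {t : ℕ → ℕ} (ht : StrictMono t) (ht0 : t 0 = 0) {k : ℕ}
    (hp : t k < p) :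
    (univ.filter fun n : ZMod p => (∀ i ≤ k, orderOf (n + (t i : ℕ)) = p - 1) ∧
      ∀ u ≤ t k, (∀ i ≤ k, u ≠ t i) → ¬ orderOf (n + u) = p - 1).card ≤
    (gapPositions p t k).card + t k := by
  refine (card_le_card (t := (gapPositions p t k).image
    (fun m => ((primRootsList p).getD m 0 : ZMod p)) ∪
      (Ico (p - t k) p).image (fun m : ℕ => (m : ZMod p))) ?_).trans
    ((card_union_le _ _).trans (add_le_add card_image_le ?_))
  · intro n hn
    obtain ⟨-, hnA, hnB⟩ := mem_filter.1 hn
    have hnp := ZMod.val_lt n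
    by_cases hbig : p - t k ≤ n.val
    · exact mem_union_right _ (mem_image.2 ⟨n.val, mem_Ico.2 ⟨hbig, hnp⟩, ZMod.natCast_zmod_val n⟩)
    refine mem_union_left _ (mem_image.2 ?_)
    have hiff : ∀ u ≤ t k, n.val + u ∈ primRootsList p ↔ orderOf (n + u) = p - 1 := by
      intro u hu
      rw [mem_primRootsList_iff_of_lt (by omega), Nat.cast_add, ZMod.natCast_zmod_val]
    have hmem : ∀ i ≤ k, n.val + t i ∈ primRootsList p := fun i hi =>
      (hiff _ (ht.monotone hi)).2 (hnA i hi)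
    have hnot : ∀ u ≤ t k, (∀ i ≤ k, u ≠ t i) → n.val + u ∉ primRootsList p :=
      fun u hu hne h => hnB u hu hne ((hiff u hu).1 h)
    obtain ⟨m, hm, hmx⟩ := List.mem_iff_getElem.1 (by simpa [ht0] using hmem 0 (by omega))
    have hcons := sortedLT_primRootsList.getElem_add_eq ht ht0 hm hmx hmem hnot
    refine ⟨m, mem_filter.2 ⟨?_, fun i hi => ?_⟩, ?_⟩
    · obtain ⟨h, -⟩ := hcons k le_rfl
      rw [length_primRootsList] at h
      rw [mem_range]
      omega
    · obtain ⟨h, hi'⟩ := hcons i hi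
      rw [List.getD_eq_getElem _ _ h, hi', List.getD_eq_getElem _ _ hm, hmx]
    · rw [List.getD_eq_getElem _ _ hm, hmx, ZMod.natCast_zmod_val]
  · refine card_image_le.trans ?_
    rw [Nat.card_Ico]
    omega

theorem le_card_gapPositions {K : ℕ} {η E : ℝ}
    (hE : ∀ S : Finset (ZMod p), S.card ≤ K →
      |((univ.filter fun n : ZMod p => ∀ s ∈ S, orderOf (n - s) = p - 1).card : ℝ) -
        p * η ^ S.card| ≤ E)
    {t : ℕ → ℕ} (ht : StrictMono t) (ht0 : t 0 = 0) {k : ℕ} (hK : t k + 1 ≤ K) (hp : t k < p) :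
    p * (η ^ (k + 1) * (1 - η) ^ (t k - k)) - 2 ^ (t k - k) * E - t k ≤
      ((gapPositions p t k).card : ℝ) := by
  classical
  have hinj : Set.InjOn (fun u : ℕ => -(u : ZMod p)) (range (t k + 1)) := by
    intro u hu v hv huv
    simp only [coe_range, Set.mem_Iio] at hu hv
    have h1 : ((u : ℕ) : ZMod p).val = (v : ZMod p).val := by rw [neg_injective huv]
    rwa [ZMod.val_natCast_of_lt (by omega), ZMod.val_natCast_of_lt (by omega)] at h1
  obtain ⟨I, hI⟩ : ∃ I, I = (range (k + 1)).image t := ⟨_, rfl⟩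
  have hImem : ∀ u, u ∈ I ↔ ∃ i ≤ k, t i = u := by
    intro u
    simp only [hI, mem_image, mem_range, Nat.lt_succ_iff]
  have hIsub : I ⊆ range (t k + 1) := by
    intro u hu
    obtain ⟨i, hi, rfl⟩ := (hImem u).1 hu
    have := ht.monotone hi
    rw [mem_range]
    omega
  have hIcard : I.card = k + 1 := by rw [hI, card_image_of_injective _ ht.injective, card_range]
  have hAcard : (I.image fun u : ℕ => -(u : ZMod p)).card = k + 1 := by
    rw [card_image_of_injOn (hinj.mono (coe_subset.2 hIsub)), hIcard]
  have hBcard : ((range (t k + 1) \ I).image fun u : ℕ => -(u : ZMod p)).card = t k - k := by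
    rw [card_image_of_injOn (hinj.mono (coe_subset.2 sdiff_subset)),
      card_sdiff_of_subset hIsub, card_range, hIcard]
    omega
  have hkt : k ≤ t k := ht.id_le k
  have hdis : Disjoint (I.image fun u : ℕ => -(u : ZMod p))
      ((range (t k + 1) \ I).image fun u : ℕ => -(u : ZMod p)) := by
    rw [disjoint_left]
    intro y hyA hyB
    obtain ⟨u, hu, rfl⟩ := mem_image.1 hyA
    obtain ⟨v, hv, huv⟩ := mem_image.1 hyB
    rw [mem_sdiff] at hv
    rw [hinj (mem_coe.2 hv.1) (mem_coe.2 (hIsub hu)) huv] at hv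
    exact hv.2 hu
  have hmain := abs_card_filter_and_not_sub_le (Ω := ZMod p) (X := p) (K := K) (η := η) (E := E)
    (P := fun (s : ZMod p) n => orderOf (n - s) = p - 1) (fun S hS => by convert hE S hS)
    _ _ hdis (by rw [hAcard, hBcard]; omega)
  rw [hAcard, hBcard] at hmain
  have key : ∀ N : ℕ, |(N : ℝ) - p * (η ^ (k + 1) * (1 - η) ^ (t k - k))| ≤ 2 ^ (t k - k) * E →
      N ≤ (gapPositions p t k).card + t k →
      p * (η ^ (k + 1) * (1 - η) ^ (t k - k)) - 2 ^ (t k - k) * E - t k ≤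
        ((gapPositions p t k).card : ℝ) := by
    intro N h1 h2
    have h3 : (N : ℝ) ≤ (gapPositions p t k).card + t k := by exact_mod_cast h2
    have h4 := (abs_le.1 h1).1
    linarith
  refine key _ hmain ((card_le_card fun n hn => ?_).trans (card_filter_gaps_le ht ht0 hp))
  simp only [mem_filter, mem_univ, true_and] at hn
  obtain ⟨hnA, hnB⟩ := hn
  refine mem_filter.2 ⟨mem_univ _, fun i hi => ?_, fun u hu hne h => ?_⟩
  · rw [← sub_neg_eq_add]
    exact hnA _ (mem_image_of_mem _ ((hImem _).2 ⟨i, hi, rfl⟩))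
  · rw [← sub_neg_eq_add] at h
    refine hnB _ (mem_image_of_mem _ (mem_sdiff.2 ⟨mem_range.2 (by omega), fun hu' => ?_⟩)) h
    obtain ⟨i, hi, hiu⟩ := (hImem u).1 hu'
    exact hne i hi hiu.symm

end PatternCount

section PatternWeights
open Finset

variable {k : ℕ}

/-- Gaps with the parities prescribed by the pattern `a`, continued by ones. -/
def patternGap (a : Fin k → Fin 2) (j : Fin k → ℕ) (i : ℕ) : ℕ :=
  if h : i < k then 2 * j ⟨i, h⟩ + (if a ⟨i, h⟩ = 1 then 1 else 2) else 1

theorem patternGap_of_fin (a : Fin k → Fin 2) (j : Fin k → ℕ) (i : Fin k) :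
    patternGap a j i = 2 * j i + (if a i = 1 then 1 else 2) := by
  simp [patternGap]

theorem patternGap_pos (a : Fin k → Fin 2) (j : Fin k → ℕ) (i : ℕ) : 0 < patternGap a j i := by
  unfold patternGap
  split_ifs <;> omega

theorem strictMono_sum_patternGap (a : Fin k → Fin 2) (j : Fin k → ℕ) :
    StrictMono fun i => ∑ x ∈ range i, patternGap a j x := by
  refine strictMono_nat_of_lt_succ fun i => ?_
  rw [sum_range_succ]
  exact Nat.lt_add_of_pos_right (patternGap_pos a j i)

theorem sum_patternGap (a : Fin k → Fin 2) (j : Fin k → ℕ) :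
    ∑ x ∈ range k, patternGap a j x = ∑ i, (2 * j i + (if a i = 1 then 1 else 2)) := by
  rw [← Fin.sum_univ_eq_sum_range]
  exact sum_congr rfl fun i _ => patternGap_of_fin a j i

theorem sum_patternGap_le (a : Fin k → Fin 2) {j : Fin k → ℕ} {G : ℕ} (hj : ∀ i, j i < G) :
    ∑ x ∈ range k, patternGap a j x ≤ 2 * G * k := by
  rw [sum_patternGap]
  refine (sum_le_card_nsmul _ _ (2 * G) fun i _ => ?_).trans ?_
  · have := hj i
    split_ifs <;> omega
  · simp [mul_comm]

/-- The limiting frequency of the bit `b` when primitive roots have density `η`. -/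
noncomputable def bitWeight (η : ℝ) (b : Fin 2) : ℝ :=
  if b = 1 then 1 / (2 - η) else (1 - η) / (2 - η)

theorem bitWeight_nonneg {η : ℝ} (h1 : η ≤ 1) (b : Fin 2) : 0 ≤ bitWeight η b := by
  unfold bitWeight
  split_ifs
  · exact div_nonneg zero_le_one (by linarith)
  · exact div_nonneg (by linarith) (by linarith)

theorem sum_bitWeight {η : ℝ} (h1 : η ≤ 1) : ∑ b, bitWeight η b = 1 := by
  rw [Fin.sum_univ_two, bitWeight, bitWeight, if_neg (by decide), if_pos rfl, ← add_div,
    div_eq_one_iff_eq (by linarith)]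
  ring

theorem prod_bitWeight (η : ℝ) (a : Fin k → Fin 2) :
    ∏ i, bitWeight η (a i) = (1 / (2 - η)) ^ (univ.filter fun i => a i = 1).card *
      ((1 - η) / (2 - η)) ^ (k - (univ.filter fun i => a i = 1).card) := by
  simp only [bitWeight]
  rw [prod_ite, prod_const, prod_const]
  congr 2
  have := card_filter_add_card_filter_not (s := (univ : Finset (Fin k))) (fun i => a i = 1)
  rw [card_univ, Fintype.card_fin] at this
  omega

theorem sum_geom_bitWeight {η : ℝ} (h0 : 0 < η) (h1 : η ≤ 1) (b : Fin 2) (G : ℕ) :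
    ∑ j ∈ range G, η * (1 - η) ^ (2 * j + (if b = 1 then 1 else 2) - 1) =
      bitWeight η b * (1 - (1 - η) ^ (2 * G)) := by
  have hq : (1 - η) ^ 2 ≠ 1 := by
    intro h
    have : η * (2 - η) = 0 := by linarith
    rcases mul_eq_zero.1 this with h | h <;> linarith
  have h2 : (2 - η) ≠ 0 := by linarith
  have hgeom := geom_sum_eq hq G
  have hqe : (1 - η) ^ 2 - 1 = -(η * (2 - η)) := by ring
  rw [hqe, ← pow_mul] at hgeom
  unfold bitWeight
  split_ifs with hb
  · rw [sum_congr rfl fun j _ => by rw [Nat.add_sub_cancel, pow_mul], ← mul_sum, hgeom]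
    field_simp
    ring
  · rw [sum_congr rfl fun j _ => by
      rw [show 2 * j + 2 - 1 = 2 * j + 1 by omega, pow_succ, pow_mul, mul_comm _ (1 - η),
        ← mul_assoc], ← mul_sum, hgeom]
    field_simp
    ring

theorem sum_pow_patternGap {η : ℝ} (h0 : 0 < η) (h1 : η ≤ 1) (a : Fin k → Fin 2) (G : ℕ) :
    ∑ j ∈ Fintype.piFinset fun _ : Fin k => range G,
      η ^ k * (1 - η) ^ (∑ x ∈ range k, patternGap a j x - k) =
      (∏ i, bitWeight η (a i)) * (1 - (1 - η) ^ (2 * G)) ^ k := by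
  have h3 : (1 - (1 - η) ^ (2 * G)) ^ k = ∏ _i : Fin k, (1 - (1 - η) ^ (2 * G)) := by
    rw [prod_const, card_univ, Fintype.card_fin]
  rw [h3, ← prod_mul_distrib, prod_congr rfl fun i _ => (sum_geom_bitWeight h0 h1 (a i) G).symm,
    prod_univ_sum]
  refine sum_congr rfl fun j _ => ?_
  rw [prod_mul_distrib, prod_const, card_univ, Fintype.card_fin, prod_pow_eq_pow_sum,
    sum_patternGap]
  congr 2
  rw [Finset.sum_tsub_distrib]
  · simp
  · intro i _
    split_ifs <;> omega

end PatternWeights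

section PatternCountLower
open Finset

variable {k p : ℕ}

/-- The occurrences of the pattern `a` in one period. -/
noncomputable def patternPositions (p : ℕ) (a : Fin k → Fin 2) : Finset ℕ :=
  (range ((p - 1).totient - 1 - k + 1)).filter fun n => ∀ i : Fin k, seqS p (n + (i : ℕ)) = (a i : ℕ)

theorem gapPositions_subset_patternPositions (a : Fin k → Fin 2) (j : Fin k → ℕ) :
    gapPositions p (fun i => ∑ x ∈ range i, patternGap a j x) k ⊆ patternPositions p a := by
  intro n hn
  obtain ⟨hn1, hn2⟩ := mem_filter.1 hn
  rw [mem_range] at hn1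
  refine mem_filter.2 ⟨mem_range.2 (by omega), fun i => ?_⟩
  have hi := i.2
  have h1 := hn2 i hi.le
  have h2 := hn2 (i + 1) hi
  simp only [sum_range_succ, patternGap_of_fin] at h1 h2
  have hmod : (n + (i : ℕ)) % ((p - 1).totient - 1) = n + i := Nat.mod_eq_of_lt (by omega)
  rw [seqS, hmod, add_assoc n, h2, h1]
  rcases Fin.exists_fin_two.1 ⟨a i, rfl⟩ with h | h <;> simp [h] <;> omega

theorem disjoint_gapPositions {a : Fin k → Fin 2} {j j' : Fin k → ℕ} (hj : j ≠ j') :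
    Disjoint (gapPositions p (fun i => ∑ x ∈ range i, patternGap a j x) k)
      (gapPositions p (fun i => ∑ x ∈ range i, patternGap a j' x) k) := by
  rw [disjoint_left]
  intro n hn hn'
  refine hj (funext fun i => ?_)
  have hi := i.2
  have h1 := (mem_filter.1 hn).2 i hi.le
  have h2 := (mem_filter.1 hn).2 (i + 1) hi
  have h1' := (mem_filter.1 hn').2 i hi.le
  have h2' := (mem_filter.1 hn').2 (i + 1) hi
  simp only [sum_range_succ, patternGap_of_fin] at h1 h2 h1' h2'
  omega

theorem le_card_patternPositions [Fact p.Prime] {K : ℕ} {η E : ℝ} (h0 : 0 < η) (h1 : η ≤ 1)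
    (hE : ∀ S : Finset (ZMod p), S.card ≤ K →
      |((univ.filter fun n : ZMod p => ∀ s ∈ S, orderOf (n - s) = p - 1).card : ℝ) -
        p * η ^ S.card| ≤ E)
    (a : Fin k → Fin 2) {G : ℕ} (hK : 2 * G * k + 1 ≤ K) (hp : 2 * G * k < p) :
    p * η * ((∏ i, bitWeight η (a i)) * (1 - (1 - η) ^ (2 * G)) ^ k) -
      G ^ k * (2 ^ (2 * G * k) * E + 2 * G * k) ≤ ((patternPositions p a).card : ℝ) := by
  have hE0 : 0 ≤ E := (abs_nonneg _).trans (hE ∅ (by simp))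
  set J := Fintype.piFinset fun _ : Fin k => range G with hJ
  have hcard : (J.card : ℝ) = G ^ k := by simp [hJ, Fintype.card_piFinset]
  have hle : ∑ j ∈ J, (gapPositions p (fun i => ∑ x ∈ range i, patternGap a j x) k).card ≤
      (patternPositions p a).card := by
    rw [← card_biUnion fun j _ j' _ hjj' => disjoint_gapPositions hjj']
    exact card_le_card (biUnion_subset.2 fun j _ => gapPositions_subset_patternPositions a j)
  refine le_trans ?_ (Nat.cast_le.2 hle)
  have hconst : ∀ c : ℝ, (G : ℝ) ^ k * c = ∑ _j ∈ J, c := by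
    intro c
    rw [sum_const, nsmul_eq_mul, hcard]
  rw [← sum_pow_patternGap h0 h1, hconst, mul_sum, ← sum_sub_distrib, Nat.cast_sum]
  refine sum_le_sum fun j hj => ?_
  have hjG : ∀ i, j i < G := fun i => mem_range.1 (Fintype.mem_piFinset.1 hj i)
  have ht := sum_patternGap_le a hjG
  have h2 := le_card_gapPositions hE (strictMono_sum_patternGap a j) (by simp) (k := k)
    (ht.trans (by omega) |> Nat.succ_le_succ |>.trans hK) (ht.trans_lt hp)
  refine le_trans ?_ h2
  have h3 : (2 : ℝ) ^ (∑ x ∈ range k, patternGap a j x - k) * E ≤ 2 ^ (2 * G * k) * E := by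
    refine mul_le_mul_of_nonneg_right (pow_le_pow_right₀ one_le_two ?_) hE0
    omega
  have h4 : ((∑ x ∈ range k, patternGap a j x : ℕ) : ℝ) ≤ 2 * G * k := by exact_mod_cast ht
  have h5 : p * η * (η ^ k * (1 - η) ^ (∑ x ∈ range k, patternGap a j x - k)) =
    p * (η ^ (k + 1) * (1 - η) ^ (∑ x ∈ range k, patternGap a j x - k)) := by ring
  rw [h5]
  linarith

theorem sum_card_patternPositions_le :
    ∑ a : Fin k → Fin 2, (patternPositions p a).card ≤ (p - 1).totient - 1 - k + 1 := by
  rw [← card_biUnion]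
  · refine (card_le_card (biUnion_subset.2 fun a _ => filter_subset _ _)).trans ?_
    rw [card_range]
  · intro a _ b _ hab
    rw [Function.onFun, disjoint_left]
    intro n hn hn'
    exact hab (funext fun i => Fin.ext
      (((mem_filter.1 hn).2 i).symm.trans ((mem_filter.1 hn').2 i)))

/-- Lower bounds for all pattern counts force asymptotics, as the counts sum to at most `T`. -/
theorem abs_card_patternPositions_sub_le {η δ T : ℝ} (h1 : η ≤ 1) (hδ : 0 ≤ δ)
    (hT : (((p - 1).totient - 1 - k + 1 : ℕ) : ℝ) ≤ T)
    (h : ∀ a : Fin k → Fin 2, T * (∏ i, bitWeight η (a i) - δ) ≤ ((patternPositions p a).card : ℝ))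
    (a : Fin k → Fin 2) :
    |((patternPositions p a).card : ℝ) - T * ∏ i, bitWeight η (a i)| ≤ 2 ^ k * (δ * T) := by
  have hsum : ∑ a : Fin k → Fin 2, ∏ i, bitWeight η (a i) = 1 := by
    have := prod_univ_sum (fun _ : Fin k => (univ : Finset (Fin 2))) fun _ b => bitWeight η b
    rw [Fintype.piFinset_univ] at this
    rw [← this, prod_congr rfl fun i _ => sum_bitWeight h1, prod_const_one]
  have hnn : ∀ b : Fin k → Fin 2,
      0 ≤ ((patternPositions p b).card : ℝ) - T * (∏ i, bitWeight η (b i) - δ) :=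
    fun b => sub_nonneg.2 (h b)
  have htot : ∑ b : Fin k → Fin 2,
      (((patternPositions p b).card : ℝ) - T * (∏ i, bitWeight η (b i) - δ)) ≤ 2 ^ k * (δ * T) := by
    rw [sum_sub_distrib, ← mul_sum, sum_sub_distrib, hsum, sum_const, card_univ]
    have h2 : ((∑ a : Fin k → Fin 2, (patternPositions p a).card : ℕ) : ℝ) ≤ T :=
      (Nat.cast_le.2 sum_card_patternPositions_le).trans hT
    rw [Nat.cast_sum] at h2
    simp only [Fintype.card_pi, Fintype.card_fin, prod_const, card_univ, nsmul_eq_mul]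
    push_cast
    linarith
  have hone := (single_le_sum (fun b _ => hnn b) (mem_univ a)).trans htot
  have hδT : 0 ≤ δ * T := mul_nonneg hδ ((Nat.cast_nonneg _).trans hT)
  have hpow : δ * T ≤ 2 ^ k * (δ * T) := le_mul_of_one_le_left hδT (one_le_pow₀ one_le_two)
  have ha := h a
  rw [abs_le]
  constructor <;> linarith

end PatternCountLower

section PrimeFactorProduct
open Finset

theorem three_mul_card_lt_of_forall_le {Q : Finset ℕ} {m : ℕ} (hm : m ∈ Q)
    (hQ : ∀ q ∈ Q, q.Prime ∧ 5 ≤ q) (hle : ∀ q ∈ Q, q ≤ m) : 3 * Q.card < m := by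
  have hmod : ∀ q ∈ Q, q % 6 = 1 ∨ q % 6 = 5 := by
    intro q hq
    obtain ⟨hp, h5⟩ := hQ q hq
    have h2 : ¬ 2 ∣ q := fun h => by
      have := (Nat.prime_dvd_prime_iff_eq Nat.prime_two hp).1 h
      omega
    have h3 : ¬ 3 ∣ q := fun h => by
      have := (Nat.prime_dvd_prime_iff_eq Nat.prime_three hp).1 h
      omega
    omega
  have hcard : Q.card ≤ (Icc 1 (m / 3)).card := by
    refine card_le_card_of_injOn (· / 3) (fun q hq => ?_) fun q hq q' hq' h => ?_
    · have h1 := hle q hq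
      have h2 := (hQ q hq).2
      simp only [coe_Icc, Set.mem_Icc]
      omega
    · have h1 := hmod q hq
      have h2 := hmod q' hq'
      simp only at h
      omega
  have h1 := hmod m hm
  rw [Nat.card_Icc] at hcard
  omega

theorem le_prod_one_sub_pow_three (Q : Finset ℕ) (hQ : ∀ q ∈ Q, q.Prime ∧ 5 ≤ q) :
    1 / (3 * (Q.card : ℝ) + 1) ≤ (∏ q ∈ Q, (1 - 1 / q : ℝ)) ^ 3 := by
  induction Q using Finset.induction_on_max with
  | empty => simp
  | insert m Q hlt ih =>
    have hmQ : m ∉ Q := fun h => lt_irrefl _ (hlt m h)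
    have h1 := three_mul_card_lt_of_forall_le (mem_insert_self m Q) hQ
      (forall_mem_insert _ _ _ |>.2 ⟨le_rfl, fun q hq => (hlt q hq).le⟩)
    rw [card_insert_of_notMem hmQ] at h1 ⊢
    have h2 : (3 * ((Q.card : ℝ) + 1) + 1) ≤ m := by exact_mod_cast h1
    have hQ0 : (0 : ℝ) ≤ Q.card := Nat.cast_nonneg _
    have hm0 : (0 : ℝ) < m := by linarith
    rw [prod_insert hmQ, mul_pow]
    have h3 : 1 - 3 / (3 * ((Q.card : ℝ) + 1) + 1) ≤ (1 - 1 / m : ℝ) ^ 3 := by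
      have h4 := one_add_mul_le_pow (a := -(1 / m : ℝ))
        (by linarith [one_div_natCast_le_one m]) 3
      have h5 : 3 / (m : ℝ) ≤ 3 / (3 * ((Q.card : ℝ) + 1) + 1) :=
        div_le_div_of_nonneg_left (by norm_num) (by positivity) h2
      have h6 : 3 / (m : ℝ) = 3 * (1 / m) := by ring
      push_cast at h4
      rw [sub_eq_add_neg (1 : ℝ) (1 / m)]
      linarith
    have h7 : 1 / (3 * ((Q.card : ℝ) + 1) + 1) =
        (1 - 3 / (3 * ((Q.card : ℝ) + 1) + 1)) * (1 / (3 * (Q.card : ℝ) + 1)) := by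
      field_simp
      ring
    push_cast
    rw [h7]
    refine mul_le_mul h3 (ih fun q hq => hQ q (mem_insert_of_mem hq)) (by positivity) ?_
    exact pow_nonneg (by linarith [one_div_natCast_le_one m]) 3

theorem le_prod_primeFactors_pow_three (N : ℕ) :
    1 / (27 * (3 * (N.primeFactors.card : ℝ) + 1)) ≤
      (∏ q ∈ N.primeFactors, (1 - 1 / q : ℝ)) ^ 3 := by
  have hq0 : ∀ q : ℕ, (0 : ℝ) ≤ 1 - 1 / q := fun q => sub_nonneg.2 (one_div_natCast_le_one q)
  rw [← prod_filter_mul_prod_filter_not N.primeFactors (5 ≤ ·), mul_pow]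
  have h1 := le_prod_one_sub_pow_three (N.primeFactors.filter (5 ≤ ·)) fun q hq =>
    ⟨Nat.prime_of_mem_primeFactors (mem_filter.1 hq).1, (mem_filter.1 hq).2⟩
  have h2 : (1 / 3 : ℝ) ≤ ∏ q ∈ N.primeFactors.filter (fun q => ¬ 5 ≤ q), (1 - 1 / q : ℝ) := by
    have hsub : N.primeFactors.filter (fun q => ¬ 5 ≤ q) ⊆ {2, 3} := by
      intro q hq
      obtain ⟨hq1, hq2⟩ := mem_filter.1 hq
      have hp := Nat.prime_of_mem_primeFactors hq1
      have := hp.two_le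
      have h4 : q ≠ 4 := by
        rintro rfl
        exact absurd hp (by decide)
      rw [mem_insert, mem_singleton]
      omega
    calc (1 / 3 : ℝ) = ∏ q ∈ ({2, 3} : Finset ℕ), (1 - 1 / q : ℝ) := by norm_num
      _ ≤ _ := prod_le_prod_of_subset_of_le_one hsub (fun q _ => hq0 q) fun q _ _ =>
        sub_le_self _ (by positivity)
  have h3 : 1 / (3 * (N.primeFactors.card : ℝ) + 1) ≤
      1 / (3 * ((N.primeFactors.filter (5 ≤ ·)).card : ℝ) + 1) := by
    refine one_div_le_one_div_of_le (by positivity) ?_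
    have : ((N.primeFactors.filter (5 ≤ ·)).card : ℝ) ≤ N.primeFactors.card :=
      Nat.cast_le.2 (card_filter_le _ _)
    linarith
  calc 1 / (27 * (3 * (N.primeFactors.card : ℝ) + 1))
      = 1 / (3 * (N.primeFactors.card : ℝ) + 1) * (1 / 3) ^ 3 := by field_simp; norm_num
    _ ≤ _ := mul_le_mul (h3.trans h1) (pow_le_pow_left₀ (by norm_num) h2 3) (by positivity)
      (pow_nonneg (prod_nonneg fun q _ => hq0 q) 3)

theorem two_pow_card_primeFactors_le {N : ℕ} (hN : N ≠ 0) : 2 ^ N.primeFactors.card ≤ N :=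
  (pow_card_le_prod _ _ _ fun _ hq => (Nat.prime_of_mem_primeFactors hq).two_le).trans
    (Nat.le_of_dvd (Nat.pos_of_ne_zero hN) (Nat.prod_primeFactors_dvd N))

theorem exp_sum_primeFactors_mul_prod_le (N : ℕ) :
    Real.exp (∑ q ∈ N.primeFactors, (1 / q : ℝ)) * ∏ q ∈ N.primeFactors, (1 - 1 / q : ℝ) ≤ 1 := by
  rw [Real.exp_sum, ← prod_mul_distrib]
  refine prod_le_one (fun q _ => ?_) fun q _ => ?_
  · exact mul_nonneg (Real.exp_pos _).le (sub_nonneg.2 (one_div_natCast_le_one q))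
  · have h := Real.one_sub_le_exp_neg (1 / q : ℝ)
    calc Real.exp (1 / q) * (1 - 1 / q) ≤ Real.exp (1 / q) * Real.exp (-(1 / q)) :=
          mul_le_mul_of_nonneg_left h (Real.exp_pos _).le
      _ = 1 := by rw [← Real.exp_add, add_neg_cancel, Real.exp_zero]

theorem cast_totient_eq_mul_prod (N : ℕ) :
    (N.totient : ℝ) = N * ∏ q ∈ N.primeFactors, (1 - 1 / q : ℝ) := by
  have h' : ((N.totient : ℚ) : ℝ) =
      ((N : ℚ) * ∏ q ∈ N.primeFactors, (1 - (q : ℚ)⁻¹) : ℚ) := by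
    rw [Nat.totient_eq_mul_prod_factors N]
  push_cast at h'
  simpa [one_div] using h'

end PrimeFactorProduct

section ErrorTerm
open Finset

variable {p : ℕ} {x : ℝ}

theorem card_primeFactors_sub_one_le (hp : p.Prime) (hx : (p : ℝ) = Real.exp (x ^ 20)) :
    ((p - 1).primeFactors.card : ℝ) ≤ 3 / 2 * x ^ 20 := by
  have hp2 := hp.two_le
  have h1 : (2 : ℝ) ^ (p - 1).primeFactors.card ≤ p := by
    exact_mod_cast (two_pow_card_primeFactors_le (by omega)).trans (Nat.sub_le p 1)
  have h2 := Real.log_le_log (by positivity) h1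
  rw [Real.log_pow, hx, Real.log_exp] at h2
  have h3 := Real.log_two_gt_d9
  have h4 : (0 : ℝ) ≤ (p - 1).primeFactors.card := Nat.cast_nonneg _
  nlinarith

theorem le_prod_primeFactors_sub_one_pow_three (hp : p.Prime) (hx : (p : ℝ) = Real.exp (x ^ 20))
    (hx1 : 1 ≤ x) :
    1 / (150 * x ^ 20) ≤ (∏ q ∈ (p - 1).primeFactors, (1 - 1 / q : ℝ)) ^ 3 := by
  refine le_trans ?_ (le_prod_primeFactors_pow_three (p - 1))
  have h1 := card_primeFactors_sub_one_le hp hx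
  have h2 : 1 ≤ x ^ 20 := one_le_pow₀ hx1
  exact one_div_le_one_div_of_le (by positivity) (by linarith)

theorem le_totient_sub_one_div (hp : p.Prime) (hx : (p : ℝ) = Real.exp (x ^ 20)) (hx1 : 1 ≤ x) :
    1 / (11 * x ^ 7) ≤ ((p - 1).totient / p : ℝ) := by
  have hp2 : (2 : ℝ) ≤ p := by exact_mod_cast hp.two_le
  have h1 := le_prod_primeFactors_sub_one_pow_three hp hx hx1
  set M := ∏ q ∈ (p - 1).primeFactors, (1 - 1 / q : ℝ) with hM
  have hM0 : 0 ≤ M := prod_nonneg fun q _ => sub_nonneg.2 (one_div_natCast_le_one q)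
  have h2 : 1 / (5.5 * x ^ 7) ≤ M := by
    refine le_of_pow_le_pow_left₀ three_ne_zero hM0 (le_trans ?_ h1)
    rw [div_pow, one_pow]
    refine one_div_le_one_div_of_le (by positivity) ?_
    have : x ^ 20 ≤ x ^ 21 := pow_le_pow_right₀ hx1 (by norm_num)
    have h3 : (5.5 * x ^ 7) ^ 3 = 166.375 * x ^ 21 := by ring
    have : 0 < x ^ 20 := by positivity
    linarith
  have h3 : ((p - 1).totient : ℝ) = (p - 1) * M := by
    rw [cast_totient_eq_mul_prod, Nat.cast_sub (by exact_mod_cast hp.one_le), Nat.cast_one]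
  rw [h3, le_div_iff₀ (by linarith)]
  calc 1 / (11 * x ^ 7) * p = 1 / (5.5 * x ^ 7) * (p / 2) := by ring
    _ ≤ M * (p - 1) := mul_le_mul h2 (by linarith) (by linarith) hM0
    _ = (p - 1) * M := mul_comm _ _

theorem exp_three_mul_sum_primeFactors_le (hp : p.Prime) (hx : (p : ℝ) = Real.exp (x ^ 20))
    (hx1 : 1 ≤ x) :
    Real.exp (3 * ∑ q ∈ (p - 1).primeFactors, (1 / q : ℝ)) ≤ 150 * x ^ 20 := by
  have h1 := le_prod_primeFactors_sub_one_pow_three hp hx hx1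
  have h2 := exp_sum_primeFactors_mul_prod_le (p - 1)
  have h3 := pow_le_one₀ (n := 3) (mul_nonneg (Real.exp_pos _).le
    (prod_nonneg fun q _ => sub_nonneg.2 (one_div_natCast_le_one q))) h2
  rw [mul_pow, ← Real.exp_nat_mul, Nat.cast_ofNat] at h3
  have h4 := (mul_le_mul_of_nonneg_left h1 (Real.exp_pos _).le).trans h3
  rwa [mul_one_div, div_le_one (by positivity)] at h4

theorem abs_card_forall_primitive_sub_le_exp [Fact p.Prime] (hx : (p : ℝ) = Real.exp (x ^ 20))
    (hx8 : 8 ≤ x) {K : ℕ} (hK : 3 / 2 * x ^ 20 * K + 1 ≤ Real.exp x) (hK' : (K : ℝ) ≤ Real.exp x)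
    (hsum : 3 * (K * ∑ q ∈ (p - 1).primeFactors, (1 / q : ℝ)) ≤ x ^ 9 / 2)
    (S : Finset (ZMod p)) (hS : S.card ≤ K) :
    |((univ.filter fun n : ZMod p => ∀ s ∈ S, orderOf (n - s) = p - 1).card : ℝ) -
      p * ((p - 1).totient / p : ℝ) ^ S.card| ≤ 11 * (p * Real.exp (-(x ^ 9 / 2))) := by
  have hω := card_primeFactors_sub_one_le (Fact.out : p.Prime) hx
  have hp0 : (0 : ℝ) < p := hx ▸ Real.exp_pos _
  have hx1 : 1 ≤ x := by linarith
  have hy : 8 * x ≤ x ^ 9 := by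
    have : (8 : ℝ) ≤ x ^ 8 := hx8.trans (le_self_pow₀ hx1 (by norm_num))
    nlinarith
  have hy20 : 64 * (x ^ 9) ^ 2 ≤ x ^ 20 := by
    have : 64 ≤ x ^ 2 := by nlinarith
    have h18 : 0 ≤ x ^ 18 := by positivity
    nlinarith
  set y := x ^ 9 with hydef
  have hy1 : 1 ≤ y := by linarith
  have hSK : (S.card : ℝ) ≤ K := Nat.cast_le.2 hS
  have hyy : y ≤ y ^ 2 := le_self_pow₀ hy1 two_ne_zero
  obtain ⟨r, hr⟩ : ∃ r, r = ⌈y⌉₊ := ⟨_, rfl⟩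
  have hr1 : y ≤ r := hr ▸ Nat.le_ceil y
  have hr2 : (r : ℝ) ≤ y + 1 := by
    rw [hr]
    exact (Nat.ceil_lt_add_one (by linarith)).le
  have hrx : r * x ≤ (y + 1) * (y / 8) := by
    have : 0 ≤ y + 1 := by linarith
    gcongr
    linarith
  have hrxy : 8 * (r * x) ≤ r * y := by
    have := mul_le_mul_of_nonneg_left hy (Nat.cast_nonneg r : (0 : ℝ) ≤ r)
    linarith
  have hry : y ≤ r * y := le_mul_of_one_le_left (by linarith) (hy1.trans hr1)
  obtain ⟨z, hz⟩ : ∃ z, z = ⌈Real.exp y⌉₊ := ⟨_, rfl⟩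
  have hz1 : Real.exp y ≤ z := hz ▸ Nat.le_ceil _
  have hz2 : (z : ℝ) ≤ Real.exp (y + 1) := by
    have h1 : (z : ℝ) ≤ Real.exp y + 1 := by
      rw [hz]
      exact (Nat.ceil_lt_add_one (Real.exp_pos y).le).le
    have h2 : 1 ≤ Real.exp y := Real.one_le_exp (by linarith)
    have h3 : 2 ≤ Real.exp 1 := by linarith [Real.exp_one_gt_d9]
    rw [Real.exp_add]
    nlinarith
  have hz0 : 1 ≤ z := by
    rw [hz, Nat.one_le_ceil_iff]
    exact Real.exp_pos _
  have hDlow : Real.exp (r * y) ≤ (z : ℝ) ^ r := by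
    rw [Real.exp_nat_mul]
    exact pow_le_pow_left₀ (Real.exp_pos _).le hz1 r
  have hDhigh : ((z : ℝ) ^ r) ^ 13 ≤ Real.exp (13 * (y + 1) ^ 2) := by
    calc ((z : ℝ) ^ r) ^ 13 ≤ (Real.exp (y + 1) ^ r) ^ 13 := by gcongr
      _ = Real.exp (13 * (r * (y + 1))) := by
        rw [← Real.exp_nat_mul, ← Real.exp_nat_mul]
        norm_num
      _ ≤ _ := by
        rw [Real.exp_le_exp, pow_two]
        gcongr
  have hpD : 6 * (z ^ r) ^ 13 < p := by
    have h6 : (6 : ℝ) ≤ Real.exp 2 := by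
      have : Real.exp 2 = Real.exp 1 * Real.exp 1 := by rw [← Real.exp_add]; norm_num
      nlinarith [Real.exp_one_gt_d9]
    have : (6 : ℝ) * ((z : ℝ) ^ r) ^ 13 < p := by
      calc (6 : ℝ) * ((z : ℝ) ^ r) ^ 13 ≤ Real.exp 2 * Real.exp (13 * (y + 1) ^ 2) :=
            mul_le_mul h6 hDhigh (by positivity) (Real.exp_pos _).le
        _ = Real.exp (2 + 13 * (y + 1) ^ 2) := (Real.exp_add _ _).symm
        _ < p := by
          rw [hx, Real.exp_lt_exp]
          nlinarith
    exact_mod_cast this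
  have hSD : S.card ≤ z ^ r := by
    have h1 : (S.card : ℝ) ≤ (z : ℝ) ^ r := by
      refine (hSK.trans hK').trans (le_trans ?_ hDlow)
      rw [Real.exp_le_exp]
      linarith
    exact_mod_cast h1
  refine (abs_card_forall_primitive_sub_le S hz0 le_rfl hSD hpD (Real.exp_pos 1)).trans ?_
  set W := Real.exp (-(y / 2)) with hW
  have hS0 : (0 : ℝ) ≤ S.card := Nat.cast_nonneg _
  have hω0 : (0 : ℝ) ≤ (p - 1).primeFactors.card := Nat.cast_nonneg _
  have hSsum : 0 ≤ ∑ q ∈ (p - 1).primeFactors, (1 / q : ℝ) := by positivity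
  have hSexp : (S.card : ℝ) ≤ Real.exp x := hSK.trans hK'
  have hωS : ((p - 1).primeFactors.card : ℝ) * S.card + 1 ≤ Real.exp x :=
    le_trans (add_le_add_left (mul_le_mul hω hSK hS0 (by positivity)) 1) hK
  have hpow : (((p - 1).primeFactors.card : ℝ) * S.card + 1) ^ r ≤ Real.exp (r * x) := by
    rw [Real.exp_nat_mul]
    exact pow_le_pow_left₀ (by positivity) hωS r
  have t1 : Real.exp (Real.exp 1 * (S.card * ∑ q ∈ (p - 1).primeFactors, (1 / q : ℝ))) /
      Real.exp 1 ^ r ≤ W := by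
    rw [← Real.exp_nat_mul, mul_one, ← Real.exp_sub, hW, Real.exp_le_exp]
    have h1 : Real.exp 1 * (S.card * ∑ q ∈ (p - 1).primeFactors, (1 / q : ℝ)) ≤
        3 * (K * ∑ q ∈ (p - 1).primeFactors, (1 / q : ℝ)) := by
      have := Real.exp_one_lt_d9
      gcongr
      linarith
    linarith
  have hxW : Real.exp (r * x) * Real.exp x ≤ p * W := by
    rw [hx, hW, ← Real.exp_add, ← Real.exp_add, Real.exp_le_exp]
    linarith
  have t4 : (S.card : ℝ) ≤ p * W := by
    refine hSexp.trans (le_trans ?_ hxW)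
    exact le_mul_of_one_le_left (Real.exp_pos _).le (Real.one_le_exp (by positivity))
  have t2 : (((p - 1).primeFactors.card : ℝ) * S.card + 1) ^ r * (2 * S.card) ≤ 2 * (p * W) := by
    calc (((p - 1).primeFactors.card : ℝ) * S.card + 1) ^ r * (2 * S.card)
        ≤ Real.exp (r * x) * (2 * Real.exp x) := by gcongr
      _ = 2 * (Real.exp (r * x) * Real.exp x) := by ring
      _ ≤ _ := by linarith
  have t3 : (((p - 1).primeFactors.card : ℝ) * S.card + 1) ^ r *
      (3 * p / ((z ^ r : ℕ) : ℝ) ^ 2) ≤ 3 * (p * W) := by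
    have h1 : Real.exp (r * x) / Real.exp (r * y) ^ 2 ≤ W := by
      rw [← Real.exp_nat_mul, ← Real.exp_sub, hW, Real.exp_le_exp]
      push_cast
      linarith
    push_cast
    calc (((p - 1).primeFactors.card : ℝ) * S.card + 1) ^ r * (3 * p / ((z : ℝ) ^ r) ^ 2)
        ≤ Real.exp (r * x) * (3 * p / Real.exp (r * y) ^ 2) := by gcongr
      _ = 3 * (p * (Real.exp (r * x) / Real.exp (r * y) ^ 2)) := by ring
      _ ≤ _ := by gcongr
  have t5 : (S.card : ℝ) * (p - 1).primeFactors.card * p / z ≤ p * W := by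
    have h1 : Real.exp x / Real.exp y ≤ W := by
      rw [← Real.exp_sub, hW, Real.exp_le_exp]
      linarith
    calc (S.card : ℝ) * (p - 1).primeFactors.card * p / z
        ≤ Real.exp x * p / Real.exp y := by
          gcongr
          linarith
      _ = p * (Real.exp x / Real.exp y) := by ring
      _ ≤ _ := by gcongr
  have t1' : 2 * p * (Real.exp (Real.exp 1 *
      (S.card * ∑ q ∈ (p - 1).primeFactors, (1 / q : ℝ))) / Real.exp 1 ^ r) ≤ 2 * (p * W) := by
    rw [mul_assoc]
    gcongr
  rw [mul_add (((p - 1).primeFactors.card * S.card + 1 : ℝ) ^ r)]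
  linarith

end ErrorTerm

section Asymptotics
open Finset

theorem eventually_mul_pow_le_exp_mul (c : ℝ) (n : ℕ) {b : ℝ} (hb : 0 < b) :
    ∀ᶠ x : ℝ in Filter.atTop, c * x ^ n ≤ Real.exp (b * x) := by
  have h := (isLittleO_pow_exp_pos_mul_atTop n hb).const_mul_left c
  filter_upwards [h.bound one_pos] with x hx
  rw [one_mul, Real.norm_of_nonneg (Real.exp_pos _).le] at hx
  exact (le_abs_self _).trans hx

theorem prod_bitWeight_le_one {k : ℕ} {η : ℝ} (h1 : η ≤ 1) (a : Fin k → Fin 2) :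
    ∏ i, bitWeight η (a i) ≤ 1 := by
  refine prod_le_one (fun i _ => bitWeight_nonneg h1 _) fun i _ => ?_
  unfold bitWeight
  split_ifs <;> rw [div_le_one (by linarith)] <;> linarith

theorem mul_prod_bitWeight_sub_le_card_patternPositions {k p : ℕ} [Fact p.Prime] {x δ : ℝ}
    (hk1 : 1 ≤ k) (hx : (p : ℝ) = Real.exp (x ^ 20)) (hδ : 0 < δ) (hx8 : 8 ≤ x) (hxk : 10 * k + 2 ≤ x)
    (h1 : (6 * k + 3) * x ^ 28 ≤ Real.exp x)
    (h2 : 150 * x ^ 20 ≤ Real.exp (1 / (2 * (4 * k + 1)) * x))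
    (h3 : 528 / δ * x ^ 7 ≤ Real.exp x) (h4 : 4 * k / δ ≤ Real.exp (2 / 11 * x))
    (a : Fin k → Fin 2) :
    (((p - 1).totient - 1 - k + 1 : ℕ) : ℝ) ≤ (((p - 1).totient - 1 : ℕ) : ℝ) ∧
    (((p - 1).totient - 1 : ℕ) : ℝ) *
      (∏ i, bitWeight ((p - 1).totient / p) (a i) - δ) ≤ ((patternPositions p a).card : ℝ) := by
  have hp := (Fact.out : p.Prime)
  have hx1 : 1 ≤ x := by linarith
  have hk0 : (0 : ℝ) ≤ k := Nat.cast_nonneg k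
  have hp0 : (0 : ℝ) < p := hx ▸ Real.exp_pos _
  have hxpow : ∀ {m n : ℕ}, m ≤ n → x ^ m ≤ x ^ n := fun h => pow_le_pow_right₀ hx1 h
  have hexp : Real.exp x ≤ p := by
    rw [hx, Real.exp_le_exp]
    exact le_self_pow₀ hx1 (by norm_num)
  -- the density
  have hη := le_totient_sub_one_div hp hx hx1
  set η : ℝ := (p - 1).totient / p with hηdef
  have hη0 : 0 < η := lt_of_lt_of_le (by positivity) hη
  have hφ : ((p - 1).totient : ℝ) = p * η := by
    rw [hηdef, mul_div_cancel₀ _ hp0.ne']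
  have hη1 : η ≤ 1 := by
    rw [hηdef, div_le_one hp0]
    exact_mod_cast (Nat.totient_le _).trans (Nat.sub_le p 1)
  have hpη : p / (11 * x ^ 7) ≤ p * η := by
    rw [div_eq_mul_one_div]
    gcongr
  have hφk : 2 * ((k : ℝ) + 1) ≤ (p - 1).totient := by
    rw [hφ]
    refine le_trans ?_ hpη
    rw [le_div_iff₀ (by positivity)]
    refine le_trans ?_ (h1.trans hexp)
    have h21 : (8 : ℝ) ≤ x ^ 21 := hx8.trans (le_self_pow₀ hx1 (by norm_num))
    calc 2 * ((k : ℝ) + 1) * (11 * x ^ 7) = (22 * k + 22) * x ^ 7 := by ring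
      _ ≤ ((6 * k + 3) * x ^ 21) * x ^ 7 := by
        gcongr
        nlinarith
      _ = (6 * k + 3) * x ^ 28 := by ring
  have hφk' : 2 * (k + 1) ≤ (p - 1).totient := by exact_mod_cast hφk
  have hTφ : (((p - 1).totient - 1 : ℕ) : ℝ) = (p - 1).totient - 1 := by
    rw [Nat.cast_sub (by omega), Nat.cast_one]
  set T : ℝ := (((p - 1).totient - 1 : ℕ) : ℝ) with hT
  have hT0 : 0 ≤ T := Nat.cast_nonneg _
  refine ⟨Nat.cast_le.2 (by omega), ?_⟩
  -- the range of the gaps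
  obtain ⟨G, hG⟩ : ∃ G, G = ⌈x ^ 8⌉₊ := ⟨_, rfl⟩
  have hG1 : x ^ 8 ≤ G := hG ▸ Nat.le_ceil _
  have hG2 : (G : ℝ) ≤ 2 * x ^ 8 := by
    have := (Nat.ceil_lt_add_one (show 0 ≤ x ^ 8 by positivity)).le
    rw [← hG] at this
    have : 1 ≤ x ^ 8 := one_le_pow₀ hx1
    linarith
  have hGk : 2 * (G : ℝ) * k ≤ 4 * k * x ^ 8 := by nlinarith
  have hK : ((2 * G * k + 1 : ℕ) : ℝ) ≤ (4 * k + 1) * x ^ 8 := by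
    have : 1 ≤ x ^ 8 := one_le_pow₀ hx1
    push_cast
    linarith
  have hK1 : 3 / 2 * x ^ 20 * ((2 * G * k + 1 : ℕ) : ℝ) + 1 ≤ Real.exp x := by
    have : 1 ≤ x ^ 28 := one_le_pow₀ hx1
    calc 3 / 2 * x ^ 20 * ((2 * G * k + 1 : ℕ) : ℝ) + 1
        ≤ 3 / 2 * x ^ 20 * ((4 * k + 1) * x ^ 8) + 1 := by gcongr
      _ = (6 * k + 3 / 2) * x ^ 28 + 1 := by ring
      _ ≤ (6 * k + 3) * x ^ 28 := by linarith
      _ ≤ _ := h1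
  have hK2 : ((2 * G * k + 1 : ℕ) : ℝ) ≤ Real.exp x := by
    have : 1 ≤ x ^ 20 := one_le_pow₀ hx1
    have : (0 : ℝ) ≤ ((2 * G * k + 1 : ℕ) : ℝ) := Nat.cast_nonneg _
    nlinarith
  have hGx : (G : ℝ) ≤ Real.exp x := by
    refine le_trans ?_ h1
    have := hxpow (show 8 ≤ 28 by norm_num)
    have h28 : 0 < x ^ 28 := by positivity
    nlinarith
  have hsum : 3 * (((2 * G * k + 1 : ℕ) : ℝ) * ∑ q ∈ (p - 1).primeFactors, (1 / q : ℝ)) ≤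
      x ^ 9 / 2 := by
    have h5 := (exp_three_mul_sum_primeFactors_le hp hx hx1).trans h2
    rw [Real.exp_le_exp] at h5
    calc 3 * (((2 * G * k + 1 : ℕ) : ℝ) * ∑ q ∈ (p - 1).primeFactors, (1 / q : ℝ))
        = ((2 * G * k + 1 : ℕ) : ℝ) * (3 * ∑ q ∈ (p - 1).primeFactors, (1 / q : ℝ)) := by ring
      _ ≤ ((4 * k + 1) * x ^ 8) * (1 / (2 * (4 * k + 1)) * x) := by gcongr
      _ = x ^ 9 / 2 := by
        field_simp
  have hGp : 2 * G * k < p := by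
    have : ((2 * G * k + 1 : ℕ) : ℝ) ≤ p := hK2.trans hexp
    exact_mod_cast this
  refine le_trans ?_ (le_card_patternPositions hη0 hη1
    (abs_card_forall_primitive_sub_le_exp hx hx8 hK1 hK2 hsum) a le_rfl hGp)
  -- the main term
  set π := ∏ i, bitWeight η (a i) with hπ
  have hπ0 : 0 ≤ π := prod_nonneg fun i _ => bitWeight_nonneg hη1 _
  have hπ1 : π ≤ 1 := prod_bitWeight_le_one hη1 a
  have htail : k * (1 - η) ^ (2 * G) ≤ δ / 4 := by
    have h5 : (1 - η) ^ (2 * G) ≤ Real.exp (-(2 / 11 * x)) := by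
      calc (1 - η) ^ (2 * G) ≤ Real.exp (-η) ^ (2 * G) :=
            pow_le_pow_left₀ (by linarith) (Real.one_sub_le_exp_neg η) _
        _ = Real.exp (-(2 * G * η)) := by
          rw [← Real.exp_nat_mul]
          push_cast
          ring_nf
        _ ≤ _ := by
          rw [Real.exp_le_exp, neg_le_neg_iff]
          calc 2 / 11 * x = 2 * x ^ 8 * (1 / (11 * x ^ 7)) := by field_simp
            _ ≤ 2 * G * η := by gcongr
    rw [div_le_iff₀ hδ] at h4
    calc k * (1 - η) ^ (2 * G) ≤ k * Real.exp (-(2 / 11 * x)) := by gcongr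
      _ = (4 * k) * Real.exp (-(2 / 11 * x)) / 4 := by ring
      _ ≤ (Real.exp (2 / 11 * x) * δ) * Real.exp (-(2 / 11 * x)) / 4 := by gcongr
      _ = δ / 4 := by
        rw [mul_right_comm, ← Real.exp_add, add_neg_cancel, Real.exp_zero, one_mul]
  have hmain : T * (π - δ / 4) ≤ p * η * (π * (1 - (1 - η) ^ (2 * G)) ^ k) := by
    have hq0 : 0 ≤ (1 - η) ^ (2 * G) := pow_nonneg (by linarith) _
    have hq1 : (1 - η) ^ (2 * G) ≤ 1 := pow_le_one₀ (by linarith) (by linarith)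
    have h5 := one_add_mul_le_pow (a := -(1 - η) ^ (2 * G)) (by linarith) k
    rw [← sub_eq_add_neg] at h5
    have h6 : π - δ / 4 ≤ π * (1 - (1 - η) ^ (2 * G)) ^ k := by
      have h7 := mul_le_mul_of_nonneg_left h5 hπ0
      have h8 := mul_le_mul_of_nonneg_right hπ1 (mul_nonneg hk0 hq0)
      linarith
    refine (mul_le_mul_of_nonneg_left h6 hT0).trans ?_
    refine mul_le_mul_of_nonneg_right (by linarith) (mul_nonneg hπ0 (pow_nonneg (by linarith) _))
  -- the error term
  have herr : (G : ℝ) ^ k * (2 ^ (2 * G * k) * (11 * (p * Real.exp (-(x ^ 9 / 2)))) + 2 * G * k) ≤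
      T * (δ / 2) := by
    have hGk1 : (G : ℝ) ^ k ≤ Real.exp (k * x) := by
      rw [Real.exp_nat_mul]
      exact pow_le_pow_left₀ (Nat.cast_nonneg _) hGx k
    have h2G : (2 : ℝ) ^ (2 * G * k) ≤ Real.exp (4 * k * x ^ 8) := by
      calc (2 : ℝ) ^ (2 * G * k) ≤ Real.exp 1 ^ (2 * G * k) := by
            gcongr
            linarith [Real.exp_one_gt_d9]
        _ = Real.exp (2 * G * k) := by
          rw [← Real.exp_nat_mul]
          push_cast
          rw [mul_one]
        _ ≤ _ := Real.exp_le_exp.2 hGk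
    have hx8' : x ≤ x ^ 8 := le_self_pow₀ hx1 (by norm_num)
    have e1 : Real.exp (k * x) * (Real.exp (4 * k * x ^ 8) * Real.exp (-(x ^ 9 / 2))) ≤
        Real.exp (-x) := by
      rw [← Real.exp_add, ← Real.exp_add, Real.exp_le_exp]
      have h5 : (10 * k + 2) * x ^ 8 ≤ x ^ 9 := by
        rw [pow_succ' x 8]
        gcongr
      have h6 : k * x ≤ k * x ^ 8 := by gcongr
      linarith
    have e2 : Real.exp (k * x) * Real.exp x ≤ p * Real.exp (-x) := by
      rw [hx, ← Real.exp_add, ← Real.exp_add, Real.exp_le_exp]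
      have h5 : (k + 2) * x ≤ x ^ 20 := by
        calc (k + 2) * x ≤ x * x := by
              gcongr
              linarith
          _ = x ^ 2 := by ring
          _ ≤ x ^ 20 := hxpow (by norm_num)
      linarith
    have h2Gk : 2 * (G : ℝ) * k ≤ Real.exp x := by
      push_cast at hK2
      linarith
    calc (G : ℝ) ^ k * (2 ^ (2 * G * k) * (11 * (p * Real.exp (-(x ^ 9 / 2)))) + 2 * G * k)
        ≤ Real.exp (k * x) * (Real.exp (4 * k * x ^ 8) * (11 * (p * Real.exp (-(x ^ 9 / 2)))) +
          Real.exp x) := by gcongr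
      _ = 11 * p * (Real.exp (k * x) * (Real.exp (4 * k * x ^ 8) * Real.exp (-(x ^ 9 / 2)))) +
          Real.exp (k * x) * Real.exp x := by ring
      _ ≤ 11 * p * Real.exp (-x) + p * Real.exp (-x) := by gcongr
      _ = p / (11 * x ^ 7) * (δ / 4) * ((528 / δ * x ^ 7) * Real.exp (-x)) := by
        field_simp
        ring
      _ ≤ p / (11 * x ^ 7) * (δ / 4) * (Real.exp x * Real.exp (-x)) := by gcongr
      _ = p / (11 * x ^ 7) * (δ / 4) := by
        rw [← Real.exp_add, add_neg_cancel, Real.exp_zero, mul_one]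
      _ ≤ (2 * T) * (δ / 4) := by
        gcongr
        linarith
      _ = T * (δ / 2) := by ring
  have hTδ : 0 ≤ T * δ := mul_nonneg hT0 hδ.le
  linarith

end Asymptotics

/-- Pattern distribution: for a fixed pattern `(a_0,…,a_{ℓ-1}) ∈ F_2^ℓ` with `w` ones,
the number `N_ℓ(w)` of occurrences of the pattern among `n = 0,…,T-ℓ` satisfies
`N_ℓ(w) = ((1/(2-η))^w ((1-η)/(2-η))^{ℓ-w} + o(1)) T` with `η = φ(p-1)/p`, as `p → ∞`
through the primes. -/
theorem pattern_distribution_asymptotic (ℓ : ℕ) (hℓ : 1 ≤ ℓ) (a : Fin ℓ → Fin 2) :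
    ∀ ε : ℝ, 0 < ε → ∃ P : ℕ, ∀ p : ℕ, Nat.Prime p → P ≤ p →
      |((((Finset.range (Nat.totient (p - 1) - 1 - ℓ + 1)).filter
              fun n => ∀ i : Fin ℓ, seqS p (n + (i : ℕ)) = (a i : ℕ)).card : ℝ) -
          ((Nat.totient (p - 1) - 1 : ℕ) : ℝ) *
            (1 / (2 - (Nat.totient (p - 1) : ℝ) / (p : ℝ))) ^
              ((Finset.univ.filter fun i : Fin ℓ => a i = 1).card) *
            ((1 - (Nat.totient (p - 1) : ℝ) / (p : ℝ)) /
              (2 - (Nat.totient (p - 1) : ℝ) / (p : ℝ))) ^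
              (ℓ - (Finset.univ.filter fun i : Fin ℓ => a i = 1).card))| ≤
        ε * ((Nat.totient (p - 1) - 1 : ℕ) : ℝ) := by
  intro ε hε
  have hδ : 0 < ε / 2 ^ ℓ := by positivity
  have hx : ∀ᶠ x : ℝ in Filter.atTop, 8 ≤ x ∧ 10 * ℓ + 2 ≤ x ∧
      (6 * ℓ + 3) * x ^ 28 ≤ Real.exp x ∧
      150 * x ^ 20 ≤ Real.exp (1 / (2 * (4 * ℓ + 1)) * x) ∧
      528 / (ε / 2 ^ ℓ) * x ^ 7 ≤ Real.exp x ∧ 4 * ℓ / (ε / 2 ^ ℓ) ≤ Real.exp (2 / 11 * x) := by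
    filter_upwards [Filter.eventually_ge_atTop 8, Filter.eventually_ge_atTop (10 * (ℓ : ℝ) + 2),
      eventually_mul_pow_le_exp_mul (6 * ℓ + 3) 28 one_pos,
      eventually_mul_pow_le_exp_mul 150 20 (show (0 : ℝ) < 1 / (2 * (4 * ℓ + 1)) by positivity),
      eventually_mul_pow_le_exp_mul (528 / (ε / 2 ^ ℓ)) 7 one_pos,
      eventually_mul_pow_le_exp_mul (4 * ℓ / (ε / 2 ^ ℓ)) 0 (show (0 : ℝ) < 2 / 11 by norm_num)]
      with x h1 h2 h3 h4 h5 h6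
    rw [one_mul] at h3 h5
    rw [pow_zero, mul_one] at h6
    exact ⟨h1, h2, h3, h4, h5, h6⟩
  have hlim : Filter.Tendsto (fun p : ℕ => Real.log p ^ (1 / 20 : ℝ)) Filter.atTop Filter.atTop :=
    (tendsto_rpow_atTop (by norm_num)).comp
      (Real.tendsto_log_atTop.comp tendsto_natCast_atTop_atTop)
  obtain ⟨P, hP⟩ := Filter.eventually_atTop.1 (hlim.eventually hx)
  refine ⟨P, fun p hp hPp => ?_⟩
  obtain ⟨h8, hk, h1, h2, h3, h4⟩ := hP p hPp
  have : Fact p.Prime := ⟨hp⟩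
  have hpx : (p : ℝ) = Real.exp ((Real.log p ^ (1 / 20 : ℝ)) ^ 20) := by
    have hlog : 0 ≤ Real.log p := Real.log_natCast_nonneg p
    rw [← Real.rpow_natCast, ← Real.rpow_mul hlog]
    norm_num
    rw [Real.exp_log (by exact_mod_cast hp.pos)]
  have hmain := mul_prod_bitWeight_sub_le_card_patternPositions hℓ hpx hδ h8 hk h1 h2 h3 h4
  have hη1 : ((p - 1).totient / p : ℝ) ≤ 1 := by
    rw [div_le_one (by exact_mod_cast hp.pos)]
    exact_mod_cast (Nat.totient_le _).trans (Nat.sub_le p 1)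
  have hfin := abs_card_patternPositions_sub_le hη1 hδ.le (hmain a).1 (fun b => (hmain b).2) a
  rw [prod_bitWeight, ← mul_assoc] at hfin
  refine hfin.trans (le_of_eq ?_)
  field_simp
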